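/- (7/144) · S^⧢(Gr_4) = Alt_8 S^⧢[ I_{3,1}( (ρ_{1,2}ρ_{3,4})/(ρ_{3,2}ρ_{1,4}), ρ_1/ρ_{1,4} ) + 2·I_{3,1}( ρ_{1,2}/ρ_1, ρ_{3,2}/ρ_{3,4} ) + 6·Li_4( (ρ_1 ρ_{3,2})/(ρ_{1,2}ρ_{3,4}) ) ] in V_F^{⊗4}. -/

import Mathlib

open scoped TensorProduct
open PiTensorProduct

attribute [local instance] Classical.propDecidable

set_option maxHeartbeats 1000000
set_option synthInstance.maxHeartbeats 400000

noncomputable section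

namespace GrassPoly

variable (F : Type) [Field F]

/-- `V_F = F^× ⊗_ℤ ℚ` as a `ℚ`-vector space. -/
abbrev VF : Type := ℚ ⊗[ℤ] (Additive Fˣ)

variable {F}

/-- The class `[a]` of a nonzero field element in `V_F` (defined to be `0` for `a = 0`). -/
def cls (a : F) : VF F :=
  if h : a = 0 then 0 else (1 : ℚ) ⊗ₜ[ℤ] (Additive.ofMul (Units.mk0 a h))

variable (F) in
/-- Tensor powers of V_F over ℚ. -/
abbrev TP (n : ℕ) : Type := ⨂[ℚ]^n (VF F)

instance instTPAddCommGroup (n : ℕ) : AddCommGroup (TP F n) :=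
  Module.addCommMonoidToAddCommGroup ℚ

/-- Appending one extra tensor factor on the right. -/
def snoc {n : ℕ} : TP F n →ₗ[ℚ] VF F →ₗ[ℚ] TP F (n + 1) :=
  PiTensorProduct.lift
    ((PiTensorProduct.tprod ℚ (s := fun _ : Fin (n + 1) => VF F)).curryRight)

/-- The factor `t_i` appearing in the recursive definition of the symbol,
as a function of `(a_{i-1}, a_i, a_{i+1})`. -/
def tCoef (p a q : F) : VF F :=
  if p = a then (if a = q then 0 else cls (q - a))
  else if a = q then - cls (p - a)
  else cls ((q - a) / (p - a))

/-- The symbol `S I(a₀; a₁, …, a_m; a_{m+1})`, with the middle entries given as a list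
(of length `n`). -/
def SIaux : (n : ℕ) → (a0 : F) → (as : List F) → (b : F) → as.length = n → TP F n
  | 0, _, _, _, _ => tprod ℚ (fun i : Fin 0 => i.elim0)
  | n + 1, a0, as, b, h =>
      ∑ i : Fin (n + 1),
        snoc (SIaux n a0 (as.eraseIdx i.val) b
            (by
              have hi' := i.isLt
              have hi : i.val < as.length := by omega
              have h2 := List.length_eraseIdx_of_lt hi
              omega))
          (tCoef ((a0 :: as).getD i.val 0) (as.getD i.val 0) ((as ++ [b]).getD (i.val + 1) 0))

/-- Cyclic rotation `b₁ ⊗ … ⊗ b_N ↦ b₂ ⊗ … ⊗ b_N ⊗ b₁` on tensor powers. -/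
def rotN (n : ℕ) : TP F n ≃ₗ[ℚ] TP F n :=
  PiTensorProduct.reindex ℚ (fun _ : Fin n => VF F) (finRotate n).symm

/-- Splitting off the last tensor factor. -/
def splitLast (n : ℕ) : TP F (n + 1) ≃ₗ[ℚ] (TP F n) ⊗[ℚ] (VF F) :=
  ((PiTensorProduct.reindex ℚ (fun _ : Fin (n + 1) => VF F)
      (finSumFinEquiv (m := n) (n := 1)).symm).trans
    (PiTensorProduct.tmulEquiv ℚ (VF F)).symm).trans
    (TensorProduct.congr (LinearEquiv.refl ℚ _)
      (PiTensorProduct.subsingletonEquiv (0 : Fin 1)))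

/-- The projector `Π̃_N` annihilating symbols of products. -/
def Pit : (n : ℕ) → TP F n →ₗ[ℚ] TP F n
  | 0 => LinearMap.id
  | 1 => LinearMap.id
  | (n + 2) =>
      ((splitLast (n + 1)).symm.toLinearMap
        ∘ₗ TensorProduct.map (Pit (n + 1)) LinearMap.id
        ∘ₗ (splitLast (n + 1)).toLinearMap)
      ∘ₗ ((LinearMap.id : TP F (n + 2) →ₗ[ℚ] TP F (n + 2)) - (rotN (F := F) (n + 2)).toLinearMap)

/-- The map on `V_F` induced by a field automorphism. -/
def vmap (φ : F ≃+* F) : VF F →ₗ[ℚ] VF F :=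
  TensorProduct.AlgebraTensorModule.map (LinearMap.id : ℚ →ₗ[ℚ] ℚ)
    (AddMonoidHom.toIntLinearMap
      { toFun := fun a => Additive.ofMul ((Units.map (φ : F →* F)) a.toMul)
        map_zero' := by simp
        map_add' := by intro a b; simp [_root_.map_mul] })

/-- The induced map on tensor powers. -/
def tpMap {n : ℕ} (φ : F ≃+* F) : TP F n →ₗ[ℚ] TP F n :=
  PiTensorProduct.map (fun _ => vmap φ)


/-! ### Symbols of (multiple) polylogarithms -/

/-- Symbol of `Li₂`. -/
def SLi2 (x : F) : TP F 2 := - SIaux 2 0 [x⁻¹, 0] 1 rfl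

/-- Symbol of `Li₃`. -/
def SLi3 (x : F) : TP F 3 := - SIaux 3 0 [x⁻¹, 0, 0] 1 rfl

/-- Symbol of `Li₄`. -/
def SLi4 (x : F) : TP F 4 := - SIaux 4 0 [x⁻¹, 0, 0, 0] 1 rfl

/-- Symbol of `Li₅`. -/
def SLi5 (x : F) : TP F 5 := - SIaux 5 0 [x⁻¹, 0, 0, 0, 0] 1 rfl

/-- Symbol of `I_{3,1}(x,y) = I(0; x,0,0,y; 1)`. -/
def SI31 (x y : F) : TP F 4 := SIaux 4 0 [x, 0, 0, y] 1 rfl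

/-- Symbol of `I_{4,1}(x,y) = I(0; x,0,0,0,y; 1)`. -/
def SI41 (x y : F) : TP F 5 := SIaux 5 0 [x, 0, 0, 0, y] 1 rfl

/-- Symbol of `I⁺_{4,1}(x,y) = ½ (I_{4,1}(x,y) + I_{4,1}(x,y⁻¹))`. -/
def I41p (x y : F) : TP F 5 := (2 : ℚ)⁻¹ • (SI41 x y + SI41 x y⁻¹)

/-- The anharmonic orbit of `x`, together with the signs of the
corresponding permutations in `S₃`. -/
def anhList (x : F) : List (ℚ × F) :=
  [(1, x), (1, (1 - x)⁻¹), (1, 1 - x⁻¹), (-1, x⁻¹), (-1, 1 - x), (-1, x / (x - 1))]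

/-- Symbol of `Ĩ_{3,1}(x,y) = (1/36) Σ_{σ,π ∈ S₃} sgn(σ) sgn(π) I_{3,1}(x^σ, y^π)`. -/
def tI31 (x y : F) : TP F 4 :=
  (36 : ℚ)⁻¹ •
    ((anhList x).map (fun p =>
      ((anhList y).map (fun q => (p.1 * q.1) • SI31 p.2 q.2)).sum)).sum

/-- Symbol of `Ĩ⁺_{4,1}(x,y) = (1/6) Σ_{σ ∈ S₃} sgn(σ) I⁺_{4,1}(x^σ, y)`. -/
def tI41p (x y : F) : TP F 5 :=
  (6 : ℚ)⁻¹ • ((anhList x).map (fun p => p.1 • I41p p.2 y)).sum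

/-- Symbol of `V(z; x, y) = Ĩ_{3,1}(z, [x]+[y]+[(1-x)/(1-xy)]+[1-xy]+[(1-y)/(1-xy)])`. -/
def Vc (z x y : F) : TP F 4 :=
  tI31 z x + tI31 z y + tI31 z ((1 - x) / (1 - x * y)) + tI31 z (1 - x * y)
    + tI31 z ((1 - y) / (1 - x * y))

/-- `Sym₃₆(a,b) := I_{3,1}(a,b) - Ĩ_{3,1}(a,b)` (on the level of symbols). -/
def S36 (a b : F) : TP F 4 := SI31 a b - tI31 a b

/-! ### Generic vectors -/

variable (N m : ℕ)

/-- Polynomial ring on the entries of `N` generic vectors in `m`-space. -/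
abbrev Pol : Type := MvPolynomial (Fin N × Fin m) ℚ

/-- The field of rational functions in the entries of `N` generic vectors in `m`-space. -/
abbrev FF : Type := FractionRing (Pol N m)

/-- The `j`-th coordinate of the `i`-th generic vector. -/
def gen (i : Fin N) (j : Fin m) : FF N m :=
  algebraMap (Pol N m) (FF N m) (MvPolynomial.X (i, j))

/-- `⟨i₁ … i_m⟩`: the determinant of the matrix whose columns are
the generic vectors selected by `cols`. -/
def dets (cols : Fin m → Fin N) : FF N m :=
  (Matrix.of fun r c => gen N m (cols c) r).det

/-- The field automorphism of `FF N m` induced by a permutation of the `N` vectors. -/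
def permAut (σ : Equiv.Perm (Fin N)) : FF N m ≃+* FF N m :=
  IsFractionRing.ringEquivOfRingEquiv
    ((MvPolynomial.renameEquiv ℚ (σ.prodCongr (Equiv.refl (Fin m)))).toRingEquiv)

variable {N m}

/-- Skew-symmetrization over all permutations of the `N` generic vectors. -/
def Alt {n : ℕ} (x : TP (FF N m) n) : TP (FF N m) n :=
  ∑ σ : Equiv.Perm (Fin N), (((Equiv.Perm.sign σ : ℤˣ) : ℤ) : ℚ) • tpMap (permAut N m σ) x

end GrassPoly

end

namespace GrassPoly

noncomputable section W4

/-- The field of rational functions in the entries of 8 generic vectors in 4-space. -/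
abbrev K4 : Type := FF 8 4

/-- The vector label `k ∈ {1, …, 8}` as an index. -/
def L8 (k : ℕ) : Fin 8 := ⟨(k - 1) % 8, Nat.mod_lt _ (by norm_num)⟩

/-- `⟨abcd⟩` for vector labels in `{1, …, 8}`. -/
def d4 (a b c d : ℕ) : K4 := dets 8 4 ![L8 a, L8 b, L8 c, L8 d]

/-- Vector labels taken mod 6 in `{1, …, 6}`. -/
def M6 (j : ℕ) : ℕ := (j - 1) % 6 + 1

/-- `ρ_i = ρ_{i,i+1,i+2} = ⟨i,i+1,i+2,7⟩ / ⟨i,i+1,i+2,8⟩`, indices mod 6. -/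
def rho (i : ℕ) : K4 :=
  d4 (M6 i) (M6 (i + 1)) (M6 (i + 2)) 7 / d4 (M6 i) (M6 (i + 1)) (M6 (i + 2)) 8

/-- `ρ_{i,j} = ρ_i - ρ_j`. -/
def rr (i j : ℕ) : K4 := rho i - rho j

/-- The projected cross-ratio `CR(ab|cdef) = ⟨abce⟩⟨abdf⟩ / (⟨abcf⟩⟨abde⟩)`. -/
def CR (a b c d e f : ℕ) : K4 :=
  (d4 a b c e * d4 a b d f) / (d4 a b c f * d4 a b d e)

/-- The symbol `S(Gr₄) = 2·(4!)²·Alt₈ [⟨1234⟩ ⊗ ⟨2345⟩ ⊗ ⟨3456⟩ ⊗ ⟨4567⟩]`. -/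
def SGr4 : TP K4 4 :=
  ((2 : ℚ) * ((Nat.factorial 4 : ℚ)) ^ 2) •
    Alt (tprod ℚ ![cls (d4 1 2 3 4), cls (d4 2 3 4 5), cls (d4 3 4 5 6), cls (d4 4 5 6 7)])

/-- An elementary tensor in `V_F^{⊗4}`. -/
def tp4 (a b c d : VF K4) : TP K4 4 := tprod ℚ ![a, b, c, d]

end W4

end GrassPoly

namespace GrassPoly

section Classes

variable {F : Type} [Field F]

lemma cls_of_ne {a : F} (h : a ≠ 0) :
    cls a = (1 : ℚ) ⊗ₜ[ℤ] (Additive.ofMul (Units.mk0 a h)) := by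
  simp [cls, h]

lemma cls_mul {a b : F} (ha : a ≠ 0) (hb : b ≠ 0) : cls (a * b) = cls a + cls b := by
  rw [cls_of_ne ha, cls_of_ne hb, cls_of_ne (mul_ne_zero ha hb), ← TensorProduct.tmul_add,
    ← ofMul_mul]
  congr 2
  ext
  simp

lemma cls_one : cls (1 : F) = 0 := by
  have h := cls_mul (one_ne_zero (α := F)) one_ne_zero
  rwa [one_mul, left_eq_add] at h

lemma cls_inv {a : F} (ha : a ≠ 0) : cls a⁻¹ = -cls a := by
  have h := cls_mul ha (inv_ne_zero ha)
  rw [mul_inv_cancel₀ ha, cls_one] at h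
  exact (neg_eq_of_add_eq_zero_right h.symm).symm

lemma cls_div {a b : F} (ha : a ≠ 0) (hb : b ≠ 0) : cls (a / b) = cls a - cls b := by
  rw [div_eq_mul_inv, cls_mul ha (inv_ne_zero hb), cls_inv hb, sub_eq_add_neg]

lemma cls_neg_one : cls (-1 : F) = 0 := by
  have h := cls_mul (neg_ne_zero.2 (one_ne_zero (α := F))) (neg_ne_zero.2 one_ne_zero)
  rw [neg_one_mul, neg_neg, cls_one, ← two_smul ℚ] at h
  exact (smul_eq_zero.1 h.symm).resolve_left two_ne_zero

lemma cls_neg (a : F) : cls (-a) = cls a := by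
  by_cases ha : a = 0
  · simp [ha]
  · rw [← neg_one_mul, cls_mul (neg_ne_zero.2 one_ne_zero) ha, cls_neg_one, zero_add]

lemma cls_sub_comm (a b : F) : cls (a - b) = cls (b - a) := by
  rw [← neg_sub, cls_neg]

lemma vmap_cls (φ : F ≃+* F) (a : F) : vmap φ (cls a) = cls (φ a) := by
  by_cases ha : a = 0
  · simp [ha, cls]
  · rw [cls_of_ne ha, cls_of_ne ((map_ne_zero φ).2 ha)]
    simp only [vmap, TensorProduct.AlgebraTensorModule.map_tmul, LinearMap.id_apply]
    congr 1
    simp only [AddMonoidHom.coe_toIntLinearMap, AddMonoidHom.coe_mk, ZeroHom.coe_mk, toMul_ofMul]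
    congr 1
    ext
    simp

lemma vmap_trans (φ ψ : F ≃+* F) : vmap (φ.trans ψ) = vmap ψ ∘ₗ vmap φ := by
  refine TensorProduct.AlgebraTensorModule.ext fun q a => ?_
  simp only [vmap, TensorProduct.AlgebraTensorModule.map_tmul, LinearMap.id_apply,
    LinearMap.comp_apply]
  congr 1

end Classes

section Tensors

variable {F : Type} [Field F]

lemma snoc_tprod {n : ℕ} (v : Fin n → VF F) (w : VF F) :
    snoc (tprod ℚ v) w = tprod ℚ (Fin.snoc (α := fun _ => VF F) v w) := by
  simp only [snoc, PiTensorProduct.lift.tprod]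
  rfl

lemma splitLast_tprod {n : ℕ} (v : Fin (n + 1) → VF F) :
    splitLast n (tprod ℚ v) = tprod ℚ (fun i : Fin n => v i.castSucc) ⊗ₜ[ℚ] v (Fin.last n) := by
  simp only [splitLast, LinearEquiv.trans_apply]
  rw [PiTensorProduct.reindex_tprod, PiTensorProduct.tmulEquiv_symm_apply]
  simp only [TensorProduct.congr_tmul, LinearEquiv.refl_apply,
    PiTensorProduct.subsingletonEquiv_apply_tprod]
  rfl

lemma splitLast_symm_tmul {n : ℕ} (a : TP F n) (w : VF F) :
    (splitLast n).symm (a ⊗ₜ[ℚ] w) = snoc a w := by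
  rw [LinearEquiv.symm_apply_eq]
  induction a using PiTensorProduct.induction_on with
  | smul_tprod r f =>
    rw [map_smul, LinearMap.smul_apply, map_smul, snoc_tprod, splitLast_tprod,
      TensorProduct.smul_tmul']
    simp
  | add x y hx hy => rw [map_add, LinearMap.add_apply, map_add, TensorProduct.add_tmul, hx, hy]

lemma Pit_tprod (n : ℕ) (v : Fin (n + 2) → VF F) :
    Pit (n + 2) (tprod ℚ v) =
      snoc (Pit (n + 1) (tprod ℚ fun i : Fin (n + 1) => v i.castSucc)) (v (Fin.last (n + 1)))
      - snoc (Pit (n + 1) (tprod ℚ fun i : Fin (n + 1) => v (finRotate _ i.castSucc)))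
          (v (finRotate _ (Fin.last (n + 1)))) := by
  simp only [Pit, LinearMap.comp_apply, LinearMap.sub_apply, LinearMap.id_apply, map_sub,
    LinearEquiv.coe_coe, rotN, PiTensorProduct.reindex_tprod, splitLast_tprod,
    TensorProduct.map_tmul, splitLast_symm_tmul]
  rfl

lemma snoc_two (a b w : VF F) : snoc (tprod ℚ ![a, b]) w = tprod ℚ ![a, b, w] := by
  rw [snoc_tprod]
  congr 1
  ext i
  fin_cases i <;> rfl

lemma snoc_three (a b c w : VF F) : snoc (tprod ℚ ![a, b, c]) w = tprod ℚ ![a, b, c, w] := by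
  rw [snoc_tprod]
  congr 1
  ext i
  fin_cases i <;> rfl

lemma Pit_two_tprod (a b : VF F) :
    Pit 2 (tprod ℚ ![a, b]) = tprod ℚ ![a, b] - tprod ℚ ![b, a] := by
  rw [Pit_tprod 0]
  simp only [Pit, LinearMap.id_apply, snoc_tprod]
  congr 2 <;> ext i <;> fin_cases i <;> rfl

lemma Pit_three_tprod (a b c : VF F) :
    Pit 3 (tprod ℚ ![a, b, c]) = tprod ℚ ![a, b, c] - tprod ℚ ![b, a, c]
      - (tprod ℚ ![b, c, a] - tprod ℚ ![c, b, a]) := by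
  have h (x y : VF F) (v : Fin 2 → VF F) (h0 : v 0 = x) (h1 : v 1 = y) : v = ![x, y] := by
    ext i
    fin_cases i
    · exact h0
    · exact h1
  rw [Pit_tprod 1, h a b (fun i => ![a, b, c] i.castSucc) rfl rfl,
    h b c (fun i => ![a, b, c] (finRotate _ i.castSucc)) rfl rfl, Pit_two_tprod, Pit_two_tprod,
    map_sub, map_sub, LinearMap.sub_apply, LinearMap.sub_apply, snoc_two, snoc_two, snoc_two,
    snoc_two]
  rfl

/-- The explicit form of `Π̃₄` on elementary tensors. -/
lemma Pit_four_tprod (a b c d : VF F) :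
    Pit 4 (tprod ℚ ![a, b, c, d]) =
      tprod ℚ ![a, b, c, d] - tprod ℚ ![b, a, c, d]
        - (tprod ℚ ![b, c, a, d] - tprod ℚ ![c, b, a, d])
        - (tprod ℚ ![b, c, d, a] - tprod ℚ ![c, b, d, a]
          - (tprod ℚ ![c, d, b, a] - tprod ℚ ![d, c, b, a])) := by
  have h (x y z : VF F) (v : Fin 3 → VF F) (h0 : v 0 = x) (h1 : v 1 = y) (h2 : v 2 = z) :
      v = ![x, y, z] := by
    ext i
    fin_cases i
    · exact h0
    · exact h1
    · exact h2
  rw [Pit_tprod 2, h a b c (fun i => ![a, b, c, d] i.castSucc) rfl rfl rfl,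
    h b c d (fun i => ![a, b, c, d] (finRotate _ i.castSucc)) rfl rfl rfl, Pit_three_tprod,
    Pit_three_tprod]
  simp only [map_sub, LinearMap.sub_apply]
  rw [← snoc_three a b c d, ← snoc_three b a c d, ← snoc_three b c a d, ← snoc_three c b a d,
    ← snoc_three b c d a, ← snoc_three c b d a, ← snoc_three c d b a, ← snoc_three d c b a]
  rfl

lemma tpMap_tprod {n : ℕ} (φ : F ≃+* F) (v : Fin n → VF F) :
    tpMap φ (tprod ℚ v) = tprod ℚ fun i => vmap φ (v i) := by
  simp only [tpMap, PiTensorProduct.map_tprod]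

lemma tpMap_trans {n : ℕ} (φ ψ : F ≃+* F) (x : TP F n) :
    tpMap (φ.trans ψ) x = tpMap ψ (tpMap φ x) := by
  simp only [tpMap, vmap_trans]
  rw [PiTensorProduct.map_comp]
  rfl

end Tensors

section Skew

variable {N m : ℕ}

lemma permAut_gen (σ : Equiv.Perm (Fin N)) (i : Fin N) (j : Fin m) :
    permAut N m σ (gen N m i j) = gen N m (σ i) j := by
  simp [permAut, gen]

lemma permAut_dets (σ : Equiv.Perm (Fin N)) (c : Fin m → Fin N) :
    permAut N m σ (dets N m c) = dets N m (σ ∘ c) := by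
  rw [dets, dets, RingEquiv.map_det]
  congr 1
  ext i j
  simp [permAut_gen]

lemma permAut_mul (σ τ : Equiv.Perm (Fin N)) :
    permAut N m (σ * τ) = (permAut N m τ).trans (permAut N m σ) := by
  have h : (permAut N m (σ * τ)).toRingHom = ((permAut N m τ).trans (permAut N m σ)).toRingHom := by
    refine IsLocalization.ringHom_ext (nonZeroDivisors (Pol N m)) ?_
    refine MvPolynomial.ringHom_ext (fun r => ?_) fun i => ?_
    · simp [permAut]
    · exact (permAut_gen (σ * τ) i.1 i.2).trans
        ((congrArg _ (permAut_gen τ i.1 i.2)).trans (permAut_gen σ _ _)).symm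
  exact RingEquiv.ext fun x => RingHom.congr_fun h x

/-- `Alt` as a linear map. -/
noncomputable def altL (N m n : ℕ) : TP (FF N m) n →ₗ[ℚ] TP (FF N m) n :=
  ∑ σ : Equiv.Perm (Fin N), (((Equiv.Perm.sign σ : ℤˣ) : ℤ) : ℚ) • tpMap (permAut N m σ)

lemma altL_apply {n : ℕ} (x : TP (FF N m) n) : altL N m n x = Alt x := by
  simp [altL, Alt, LinearMap.sum_apply]

lemma altL_tpMap {n : ℕ} (σ : Equiv.Perm (Fin N)) (x : TP (FF N m) n) :
    altL N m n (tpMap (permAut N m σ) x)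
      = (((Equiv.Perm.sign σ : ℤˣ) : ℤ) : ℚ) • altL N m n x := by
  simp only [altL, LinearMap.sum_apply, LinearMap.smul_apply, ← tpMap_trans, ← permAut_mul,
    Finset.smul_sum, smul_smul]
  refine Fintype.sum_equiv (Equiv.mulRight σ) _ _ fun τ => ?_
  simp only [Equiv.coe_mulRight, Equiv.Perm.sign_mul]
  congr 1
  obtain h | h := Int.units_eq_one_or (Equiv.Perm.sign σ) <;> simp [h]

lemma Pit_four_tpMap {F : Type} [Field F] (φ : F ≃+* F) (x : TP F 4) :
    Pit 4 (tpMap φ x) = tpMap φ (Pit 4 x) := by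
  induction x using PiTensorProduct.induction_on with
  | smul_tprod r f =>
    have hf (f : Fin 4 → VF F) : f = ![f 0, f 1, f 2, f 3] := by
      ext i
      fin_cases i <;> rfl
    have hv (a b c d : VF F) : tpMap φ (tprod ℚ ![a, b, c, d])
        = tprod ℚ ![vmap φ a, vmap φ b, vmap φ c, vmap φ d] := by
      rw [tpMap_tprod]
      congr 1
      ext i
      fin_cases i <;> rfl
    rw [hf f]
    simp only [map_smul, hv, Pit_four_tprod, map_sub]
  | add x y hx hy => rw [map_add, map_add, map_add, map_add, hx, hy]

lemma Pit_four_altL (x : TP (FF N m) 4) : Pit 4 (altL N m 4 x) = altL N m 4 (Pit 4 x) := by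
  simp only [altL, LinearMap.sum_apply, LinearMap.smul_apply, map_sum, map_smul, Pit_four_tpMap]

end Skew

section Symbols

variable {F : Type} [Field F]

lemma tCoef_of_ne {p a q : F} (h₁ : p ≠ a) (h₂ : q ≠ a) :
    tCoef p a q = cls (q - a) - cls (p - a) := by
  rw [tCoef, if_neg h₁, if_neg h₂.symm, cls_div (sub_ne_zero.2 h₂) (sub_ne_zero.2 h₁)]

lemma tCoef_left {a q : F} (h : q ≠ a) : tCoef a a q = cls (q - a) := by
  rw [tCoef, if_pos rfl, if_neg h.symm]

lemma tCoef_right {p a : F} (h : p ≠ a) : tCoef p a a = -cls (p - a) := by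
  rw [tCoef, if_neg h, if_pos rfl]

lemma tCoef_outer {p a : F} (h : p ≠ a) : tCoef p a p = 0 := by
  rw [tCoef_of_ne h h, sub_self]

lemma tCoef_self (a : F) : tCoef a a a = 0 := by
  simp [tCoef]

lemma snoc_zero (w : VF F) : snoc (tprod ℚ fun i : Fin 0 => i.elim0) w = tprod ℚ ![w] := by
  rw [snoc_tprod]
  congr 1
  ext i
  fin_cases i
  rfl

lemma snoc_one (a w : VF F) : snoc (tprod ℚ ![a]) w = tprod ℚ ![a, w] := by
  rw [snoc_tprod]
  congr 1
  ext i
  fin_cases i <;> rfl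

lemma SIaux_one (a₀ x b : F) (h) : SIaux 1 a₀ [x] b h = tprod ℚ ![tCoef a₀ x b] := by
  exact (Fin.sum_univ_one _).trans (snoc_zero _)

lemma SIaux_two (a₀ x y b : F) (h) : SIaux 2 a₀ [x, y] b h =
    tprod ℚ ![tCoef a₀ y b, tCoef a₀ x y] + tprod ℚ ![tCoef a₀ x b, tCoef x y b] := by
  rw [SIaux, Fin.sum_univ_two, ← snoc_one, ← snoc_one, ← SIaux_one a₀ y b rfl,
    ← SIaux_one a₀ x b rfl]
  rfl

lemma SIaux_three (a₀ x y z b : F) (h) : SIaux 3 a₀ [x, y, z] b h =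
    snoc (SIaux 2 a₀ [y, z] b rfl) (tCoef a₀ x y) + snoc (SIaux 2 a₀ [x, z] b rfl) (tCoef x y z)
      + snoc (SIaux 2 a₀ [x, y] b rfl) (tCoef y z b) := by
  rw [SIaux, Fin.sum_univ_three]
  rfl

lemma SIaux_four (a₀ x y z w b : F) (h) : SIaux 4 a₀ [x, y, z, w] b h =
    snoc (SIaux 3 a₀ [y, z, w] b rfl) (tCoef a₀ x y)
      + snoc (SIaux 3 a₀ [x, z, w] b rfl) (tCoef x y z)
      + snoc (SIaux 3 a₀ [x, y, w] b rfl) (tCoef y z w)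
      + snoc (SIaux 3 a₀ [x, y, z] b rfl) (tCoef z w b) := by
  rw [SIaux, Fin.sum_univ_four]
  rfl

lemma SIaux_zero_zero {x : F} (hx : x ≠ 0) (hx1 : x ≠ 1) :
    SIaux 3 0 [x, 0, 0] 1 rfl = tprod ℚ ![cls (1 - x) - cls x, -cls x, -cls x] := by
  rw [SIaux_three, SIaux_two, SIaux_two, tCoef_outer hx.symm, tCoef_right hx,
    tCoef_of_ne hx.symm hx1.symm, tCoef_left one_ne_zero, sub_zero, sub_zero, cls_one,
    tCoef_of_ne hx one_ne_zero, sub_zero, cls_one, zero_sub, zero_sub, cls_neg]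
  have h0 (a : VF F) : (tprod ℚ ![a, 0] : TP F 2) = 0 :=
    MultilinearMap.map_coord_zero _ (1 : Fin 2) rfl
  simp only [map_zero, h0, add_zero, zero_add, snoc_two, sub_zero]

/-- The symbol of `Li₄`. -/
lemma SLi4_eq {x : F} (hx : x ≠ 0) (hx1 : x ≠ 1) :
    SLi4 x = -tprod ℚ ![cls (1 - x), cls x, cls x, cls x] := by
  have hu : x⁻¹ ≠ 0 := inv_ne_zero hx
  have hu1 : x⁻¹ ≠ 1 := inv_ne_one.2 hx1
  have h1 : cls (1 - x⁻¹) = cls (1 - x) - cls x := by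
    rw [← cls_div (sub_ne_zero.2 hx1.symm) hx, ← cls_neg]
    congr 1
    field_simp
    ring
  have h2 : SIaux 3 0 [(0 : F), 0, 0] 1 rfl = 0 := by
    rw [SIaux_three, SIaux_two, tCoef_self, tCoef_left one_ne_zero, sub_zero, cls_one]
    have h0 (a : VF F) : (tprod ℚ ![a, 0] : TP F 2) = 0 :=
      MultilinearMap.map_coord_zero _ (1 : Fin 2) rfl
    simp [h0]
  rw [SLi4, SIaux_four, h2, SIaux_zero_zero hu hu1, tCoef_right hu, tCoef_self,
    tCoef_left one_ne_zero, sub_zero, sub_zero, cls_one, cls_inv hx, h1]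
  have h0 (a b c : VF F) : (tprod ℚ ![a, b, c, 0] : TP F 4) = 0 :=
    MultilinearMap.map_coord_zero _ (3 : Fin 4) rfl
  simp [snoc_three, h0]

/-- The symbol of `I_{3,1}`. -/
lemma SI31_eq {x y : F} (hx : x ≠ 0) (hy : y ≠ 0) (hx1 : x ≠ 1) (hy1 : y ≠ 1) (hxy : x ≠ y) :
    SI31 x y =
      tprod ℚ ![cls (1 - y) - cls y, cls (x - y) - cls x, cls y - cls x, cls y - cls x]
      + tprod ℚ ![cls (1 - x) - cls x, cls (1 - y) - cls (x - y), cls y - cls x, cls y - cls x]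
      + tprod ℚ ![cls (1 - x) - cls x, -cls x, cls (1 - y) - cls y, cls y - cls x]
      + tprod ℚ ![cls (1 - x) - cls x, -cls x, -cls x, cls (1 - y) - cls y] := by
  have h1 : SIaux 3 0 [x, 0, y] 1 rfl =
      tprod ℚ ![cls (1 - y) - cls y, cls (x - y) - cls x, cls y - cls x]
      + tprod ℚ ![cls (1 - x) - cls x, cls (1 - y) - cls (x - y), cls y - cls x]
      + tprod ℚ ![cls (1 - x) - cls x, -cls x, cls (1 - y) - cls y] := by
    rw [SIaux_three, SIaux_two 0 x y, SIaux_two 0 x 0, tCoef_outer hx.symm,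
      tCoef_of_ne hx hy, tCoef_of_ne hy.symm hy1.symm, tCoef_of_ne hx.symm hx1.symm,
      tCoef_of_ne hxy hy1.symm, tCoef_of_ne hx.symm hxy.symm, tCoef_left one_ne_zero,
      tCoef_of_ne hx one_ne_zero, sub_zero, sub_zero, sub_zero, cls_one, zero_sub, zero_sub,
      zero_sub, cls_neg, cls_neg, cls_sub_comm y x]
    have h0 (a : VF F) : (tprod ℚ ![0, a] : TP F 2) = 0 :=
      MultilinearMap.map_coord_zero _ (0 : Fin 2) rfl
    simp only [map_zero, h0, map_add, LinearMap.add_apply, zero_add, snoc_two]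
  rw [SI31, SIaux_four, h1, SIaux_zero_zero hx hx1, tCoef_outer hx.symm, tCoef_right hx,
    tCoef_left hy, tCoef_of_ne hy.symm hy1.symm, sub_zero, sub_zero, zero_sub, cls_neg]
  rw [map_zero, zero_add, ← map_add, neg_add_eq_sub]
  simp only [map_add, LinearMap.add_apply, snoc_three]

end Symbols

section Brackets

variable {N : ℕ}

/-- The bracket `⟨abcd⟩` of generic vectors in 4-space. -/
noncomputable def brk (a b c d : Fin N) : FF N 4 := dets N 4 ![a, b, c, d]

lemma brk_eq (a b c d : Fin N) : brk a b c d =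
    (gen N 4 a 0 * gen N 4 b 1 - gen N 4 a 1 * gen N 4 b 0)
        * (gen N 4 c 2 * gen N 4 d 3 - gen N 4 c 3 * gen N 4 d 2)
      - (gen N 4 a 0 * gen N 4 b 2 - gen N 4 a 2 * gen N 4 b 0)
        * (gen N 4 c 1 * gen N 4 d 3 - gen N 4 c 3 * gen N 4 d 1)
      + (gen N 4 a 0 * gen N 4 b 3 - gen N 4 a 3 * gen N 4 b 0)
        * (gen N 4 c 1 * gen N 4 d 2 - gen N 4 c 2 * gen N 4 d 1)
      + (gen N 4 a 1 * gen N 4 b 2 - gen N 4 a 2 * gen N 4 b 1)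
        * (gen N 4 c 0 * gen N 4 d 3 - gen N 4 c 3 * gen N 4 d 0)
      - (gen N 4 a 1 * gen N 4 b 3 - gen N 4 a 3 * gen N 4 b 1)
        * (gen N 4 c 0 * gen N 4 d 2 - gen N 4 c 2 * gen N 4 d 0)
      + (gen N 4 a 2 * gen N 4 b 3 - gen N 4 a 3 * gen N 4 b 2)
        * (gen N 4 c 0 * gen N 4 d 1 - gen N 4 c 1 * gen N 4 d 0) := by
  simp [brk, dets, Matrix.det_succ_row_zero, Fin.sum_univ_succ, Fin.succAbove]
  ring

lemma brk_swap₁₂ (a b c d : Fin N) : brk b a c d = -brk a b c d := by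
  rw [brk_eq, brk_eq]; ring

lemma brk_swap₂₃ (a b c d : Fin N) : brk a c b d = -brk a b c d := by
  rw [brk_eq, brk_eq]; ring

/-- The three-term Plücker relation. -/
lemma brk_plucker (x y a b e f : Fin N) :
    brk a x y e * brk x y b f - brk x y b e * brk a x y f = brk a x y b * brk x y e f := by
  simp only [brk_eq]
  ring

/-- `⟨abpe⟩⟨pcdf⟩ - ⟨abpf⟩⟨pcde⟩`, which vanishes when the lines `ab`, `cd`, `ef` meet
after projection from `p`. -/
noncomputable def conc (p a b c d e f : Fin N) : FF N 4 :=
  brk a b p e * brk p c d f - brk a b p f * brk p c d e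

lemma conc_swap₁ (p a b c d e f : Fin N) : conc p b a c d e f = -conc p a b c d e f := by
  simp only [conc, brk_swap₁₂ a b]
  ring

lemma conc_swap₂ (p a b c d e f : Fin N) : conc p a b d c e f = -conc p a b c d e f := by
  simp only [conc, brk_swap₂₃ p c d]
  ring

lemma conc_swap₃ (p a b c d e f : Fin N) : conc p a b c d f e = -conc p a b c d e f := by
  simp only [conc]
  ring

lemma conc_swap₁₂ (p a b c d e f : Fin N) : conc p c d a b e f = -conc p a b c d e f := by
  have h (x y z : Fin N) : brk x y p z = brk p x y z := by
    rw [brk_swap₂₃, brk_swap₁₂, neg_neg]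
  simp only [conc, h]
  ring

lemma conc_swap₂₃ (p a b c d e f : Fin N) : conc p a b e f c d = -conc p a b c d e f := by
  simp only [conc, brk_eq]
  ring

/-- `⟨abcg⟩⟨defh⟩ - ⟨abch⟩⟨defg⟩`, which vanishes when the planes `abc`, `def` and the line `gh`
have a common point. -/
noncomputable def meet (a b c d e f g h : Fin N) : FF N 4 :=
  brk a b c g * brk d e f h - brk a b c h * brk d e f g

end Brackets

section Letters

lemma permAut_brk {N : ℕ} (σ : Equiv.Perm (Fin N)) (a b c d : Fin N) :
    permAut N 4 σ (brk a b c d) = brk (σ a) (σ b) (σ c) (σ d) := by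
  rw [brk, permAut_dets, brk]
  congr 1
  ext i
  fin_cases i <;> rfl

/-- The colours of the eight points distinguished by the three model letters
`⟨1234⟩`, `conc 3 1 2 4 5 7 8` and `meet 1 2 3 4 5 6 7 8`. -/
def letterColor : Fin 3 → Fin 8 → ℕ :=
  ![![1, 1, 1, 1, 0, 0, 0, 0], ![2, 2, 5, 3, 3, 6, 4, 4], ![5, 5, 5, 6, 6, 6, 7, 7]]

/-- The field elements underlying the three model letters, with relabelled vectors. -/
noncomputable def letterElt (t : Fin 3) (p : Fin 8 → Fin 8) : K4 :=
  ![brk (p 0) (p 1) (p 2) (p 3), conc (p 2) (p 0) (p 1) (p 3) (p 4) (p 6) (p 7),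
    meet (p 0) (p 1) (p 2) (p 3) (p 4) (p 5) (p 6) (p 7)] t

lemma permAut_letterElt (σ : Equiv.Perm (Fin 8)) (t : Fin 3) (p : Fin 8 → Fin 8) :
    permAut 8 4 σ (letterElt t p) = letterElt t (σ ∘ p) := by
  fin_cases t <;> simp [letterElt, conc, meet, permAut_brk]

lemma brk_rotate {N : ℕ} (a b c x : Fin N) : brk b c a x = brk a b c x := by
  rw [brk_swap₂₃, brk_swap₁₂, neg_neg]

lemma brk_reverse {N : ℕ} (a b c x : Fin N) : brk c b a x = -brk a b c x := by
  rw [brk_swap₁₂, brk_rotate]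

lemma brk_three {N : ℕ} (a b c : Fin N) {a' b' c' : Fin N}
    (ha : a' = a ∨ a' = b ∨ a' = c) (hb : b' = a ∨ b' = b ∨ b' = c)
    (hc : c' = a ∨ c' = b ∨ c' = c) (hab : a' ≠ b') (hac : a' ≠ c') (hbc : b' ≠ c') :
    (∀ x, brk a' b' c' x = brk a b c x) ∨ ∀ x, brk a' b' c' x = -brk a b c x := by
  rcases ha with rfl | rfl | rfl <;> rcases hb with rfl | rfl | rfl <;>
    rcases hc with rfl | rfl | rfl <;> first | contradiction | skip
  · exact .inl fun x => rfl
  · exact .inr fun x => brk_swap₂₃ ..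
  · exact .inr fun x => brk_swap₁₂ ..
  · exact .inl fun x => brk_rotate ..
  · exact .inl fun x => (brk_rotate ..).symm
  · exact .inr fun x => brk_reverse ..

lemma cls_eq_of_eq_or_eq_neg {F : Type} [Field F] {x y : F} (h : x = y ∨ x = -y) :
    cls x = cls y := by
  rcases h with rfl | rfl
  · rfl
  · exact cls_neg y

lemma cls_brk_of_color {p : Fin 8 → Fin 8} (hp : p.Injective)
    (h : ∀ k, letterColor 0 (p k) = letterColor 0 k) :
    cls (letterElt 0 p) = cls (letterElt 0 id) := by
  have key (j : Fin 8) (hj : letterColor 0 j = 1) : j = 0 ∨ j = 1 ∨ j = 2 ∨ j = 3 := by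
    revert hj
    fin_cases j <;> simp [letterColor]
  have hk (k : Fin 4) :
      ∃ l : Fin 4, p (Fin.castLE (by norm_num) k) = Fin.castLE (by norm_num) l := by
    have hc : letterColor 0 (Fin.castLE (by norm_num) k) = 1 := by
      fin_cases k <;> rfl
    rcases key _ ((h _).trans hc) with h | h | h | h
    exacts [⟨0, h⟩, ⟨1, h⟩, ⟨2, h⟩, ⟨3, h⟩]
  choose q hq using hk
  have hinj : q.Injective := fun i j hij => by
    have := hp ((hq i).trans ((congrArg _ hij).trans (hq j).symm))
    exact Fin.castLE_injective _ this
  let σ : Equiv.Perm (Fin 4) := Equiv.ofBijective q (Finite.injective_iff_bijective.1 hinj)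
  have hdet : letterElt 0 p = (dets 8 4 fun i => Fin.castLE (by norm_num) (σ i)) := by
    simp only [letterElt, brk, Matrix.cons_val_zero]
    congr 1
    ext i
    fin_cases i
    exacts [congrArg Fin.val (hq 0), congrArg Fin.val (hq 1), congrArg Fin.val (hq 2),
      congrArg Fin.val (hq 3)]
  have hdet' : letterElt 0 id = (dets 8 4 fun i => Fin.castLE (by norm_num) i) := by
    simp only [letterElt, brk, Matrix.cons_val_zero]
    congr 1
    ext i
    fin_cases i <;> rfl
  have hperm : letterElt 0 p = (Equiv.Perm.sign σ : ℤ) * letterElt 0 id := by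
    rw [hdet, hdet', dets, dets, ← Matrix.det_permute']
    rfl
  apply cls_eq_of_eq_or_eq_neg
  rw [hperm]
  rcases Int.units_eq_one_or (Equiv.Perm.sign σ) with h | h <;> simp [h]

lemma cls_conc_of_color {p : Fin 8 → Fin 8} (hp : p.Injective)
    (h : ∀ k, letterColor 1 (p k) = letterColor 1 k) :
    cls (letterElt 1 p) = cls (letterElt 1 id) := by
  have c2 (j : Fin 8) (hj : letterColor 1 j = 2) : j = 0 ∨ j = 1 := by
    revert hj
    fin_cases j <;> simp [letterColor]
  have c3 (j : Fin 8) (hj : letterColor 1 j = 3) : j = 3 ∨ j = 4 := by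
    revert hj
    fin_cases j <;> simp [letterColor]
  have c4 (j : Fin 8) (hj : letterColor 1 j = 4) : j = 6 ∨ j = 7 := by
    revert hj
    fin_cases j <;> simp [letterColor]
  have c5 (j : Fin 8) (hj : letterColor 1 j = 5) : j = 2 := by
    revert hj
    fin_cases j <;> simp [letterColor]
  have e (i j : Fin 8) (hij : i ≠ j) : p i ≠ p j := hp.ne hij
  have e01 := e 0 1 (by simp)
  have e34 := e 3 4 (by simp)
  have e67 := e 6 7 (by simp)
  apply cls_eq_of_eq_or_eq_neg
  simp only [letterElt, Matrix.cons_val, id, c5 _ (h 2)]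
  rcases c2 _ (h 0) with h0 | h0 <;> rcases c2 _ (h 1) with h1 | h1 <;> rw [h0, h1] at e01 ⊢ <;>
    first | exact absurd rfl e01 | skip
  all_goals
    rcases c3 _ (h 3) with h3 | h3 <;> rcases c3 _ (h 4) with h4 | h4 <;> rw [h3, h4] at e34 ⊢ <;>
      first | exact absurd rfl e34 | skip
  all_goals
    rcases c4 _ (h 6) with h6 | h6 <;> rcases c4 _ (h 7) with h7 | h7 <;> rw [h6, h7] at e67 ⊢ <;>
      first | exact absurd rfl e67 | skip
  all_goals
    simp only [conc_swap₁ 2 0 1, conc_swap₂ 2 _ _ 3 4, conc_swap₃ 2 _ _ _ _ 6 7, neg_neg, true_or,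
      or_true]

lemma cls_meet_of_color {p : Fin 8 → Fin 8} (hp : p.Injective)
    (h : ∀ k, letterColor 2 (p k) = letterColor 2 k) :
    cls (letterElt 2 p) = cls (letterElt 2 id) := by
  have h5 (j : Fin 8) (hj : letterColor 2 j = 5) : j = 0 ∨ j = 1 ∨ j = 2 := by
    revert hj
    fin_cases j <;> simp [letterColor]
  have h6 (j : Fin 8) (hj : letterColor 2 j = 6) : j = 3 ∨ j = 4 ∨ j = 5 := by
    revert hj
    fin_cases j <;> simp [letterColor]
  have h7 (j : Fin 8) (hj : letterColor 2 j = 7) : j = 6 ∨ j = 7 := by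
    revert hj
    fin_cases j <;> simp [letterColor]
  have e {i j : Fin 8} (hij : i ≠ j) : p i ≠ p j := hp.ne hij
  have e67 := e (i := 6) (j := 7) (by simp)
  apply cls_eq_of_eq_or_eq_neg
  have a := brk_three 0 1 2 (h5 _ (h 0)) (h5 _ (h 1)) (h5 _ (h 2)) (e (by simp)) (e (by simp))
    (e (by simp))
  have b := brk_three 3 4 5 (h6 _ (h 3)) (h6 _ (h 4)) (h6 _ (h 5)) (e (by simp)) (e (by simp))
    (e (by simp))
  simp only [letterElt, meet, Matrix.cons_val, id]
  rcases a with a | a <;> rcases b with b | b <;> rcases h7 _ (h 6) with h6 | h6 <;>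
    rcases h7 _ (h 7) with h7 | h7 <;> rw [h6, h7] at e67 ⊢ <;>
    first
    | exact absurd rfl e67
    | (left; simp only [a, b] <;> ring1)
    | (right; simp only [a, b]; ring1)

lemma cls_letterElt_of_color (t : Fin 3) {p : Fin 8 → Fin 8} (hp : p.Injective)
    (h : ∀ k, letterColor t (p k) = letterColor t k) :
    cls (letterElt t p) = cls (letterElt t id) := by
  fin_cases t
  exacts [cls_brk_of_color hp h, cls_conc_of_color hp h, cls_meet_of_color hp h]

/-- The class of the letter with the given colouring of the eight points
(and `0` if there is no such letter). -/
noncomputable def letter (c : Fin 8 → ℕ) : VF K4 :=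
  if h : ∃ s : Fin 3 × Equiv.Perm (Fin 8), ∀ k, c (s.2 k) = letterColor s.1 k then
    cls (letterElt h.choose.1 h.choose.2) else 0

lemma letterColor_eq_of_perm {t t' : Fin 3} (π : Equiv.Perm (Fin 8))
    (h : ∀ k, letterColor t (π k) = letterColor t' k) : t = t' := by
  have hs : ∑ k, letterColor t k = ∑ k, letterColor t' k :=
    (Equiv.sum_comp π _).symm.trans (Finset.sum_congr rfl fun k _ => h k)
  revert hs
  fin_cases t <;> fin_cases t' <;> simp [letterColor, Fin.sum_univ_succ]

lemma letter_eq (t : Fin 3) (σ : Equiv.Perm (Fin 8)) {c : Fin 8 → ℕ}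
    (h : ∀ k, c (σ k) = letterColor t k) : letter c = cls (letterElt t σ) := by
  have hex : ∃ s : Fin 3 × Equiv.Perm (Fin 8), ∀ k, c (s.2 k) = letterColor s.1 k := ⟨(t, σ), h⟩
  rw [letter, dif_pos hex]
  rcases hs : hex.choose with ⟨t', σ'⟩
  have h' : ∀ k, c (σ' k) = letterColor t' k := by
    simpa only [hs] using hex.choose_spec
  have hπ (k) : letterColor t ((σ⁻¹ * σ') k) = letterColor t' k := by
    rw [← h', ← h]
    simp
  obtain rfl := letterColor_eq_of_perm _ hπ
  have := cls_letterElt_of_color t (σ⁻¹ * σ').injective hπ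
  have h1 := congrArg (vmap (permAut 8 4 σ)) this
  rw [vmap_cls, vmap_cls, permAut_letterElt, permAut_letterElt] at h1
  convert h1 using 3
  ext k
  · simp
  · rfl

lemma letter_of_injective (t : Fin 3) {p : Fin 8 → Fin 8} (hp : p.Injective) {c : Fin 8 → ℕ}
    (h : ∀ k, c (p k) = letterColor t k) : letter c = cls (letterElt t p) :=
  letter_eq t (Equiv.ofBijective p (Finite.injective_iff_bijective.1 hp)) h

lemma vmap_letter (σ : Equiv.Perm (Fin 8)) (c : Fin 8 → ℕ) :
    vmap (permAut 8 4 σ) (letter c) = letter fun k => c (σ⁻¹ k) := by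
  by_cases hex : ∃ s : Fin 3 × Equiv.Perm (Fin 8), ∀ k, c (s.2 k) = letterColor s.1 k
  · obtain ⟨⟨t, τ⟩, h⟩ := hex
    rw [letter_eq t τ h, vmap_cls, permAut_letterElt, letter_eq t (σ * τ)]
    · rfl
    · simpa using h
  · have hex' : ¬∃ s : Fin 3 × Equiv.Perm (Fin 8),
        ∀ k, c (σ⁻¹ (s.2 k)) = letterColor s.1 k := by
      rintro ⟨⟨t, τ⟩, h⟩
      exact hex ⟨(t, σ⁻¹ * τ), h⟩
    rw [letter, letter, dif_neg hex, dif_neg hex', map_zero]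

/-- Interchanging two of the three colours of pairs of points does not change a letter. -/
lemma letter_recolor {g : ℕ → ℕ} (hg : g.Involutive) (π : Fin 3 → Equiv.Perm (Fin 8))
    (hπ : ∀ t k, g (letterColor t (π t k)) = letterColor t k)
    (hπ' : ∀ t, cls (letterElt t (π t)) = cls (letterElt t id)) (c : Fin 8 → ℕ) :
    letter (fun k => g (c k)) = letter c := by
  have key (c : Fin 8 → ℕ) {t : Fin 3} {τ : Equiv.Perm (Fin 8)}
      (h : ∀ k, c (τ k) = letterColor t k) : letter (fun k => g (c k)) = letter c := by
    rw [letter_eq t τ h, letter_eq t (τ * π t) (by simp [h, hπ])]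
    have h1 := congrArg (vmap (permAut 8 4 τ)) (hπ' t)
    rw [vmap_cls, vmap_cls, permAut_letterElt, permAut_letterElt] at h1
    exact h1
  by_cases hex : ∃ s : Fin 3 × Equiv.Perm (Fin 8), ∀ k, c (s.2 k) = letterColor s.1 k
  · obtain ⟨⟨t, τ⟩, h⟩ := hex
    exact key c h
  · by_cases hex' : ∃ s : Fin 3 × Equiv.Perm (Fin 8), ∀ k, g (c (s.2 k)) = letterColor s.1 k
    · obtain ⟨⟨t, τ⟩, h⟩ := hex'
      have := key (fun k => g (c k)) h
      simpa only [hg _] using this.symm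
    · rw [letter, letter, dif_neg hex, dif_neg hex']

end Letters

section SortingColumns

variable {M : Type*} [AddCommGroup M]

/-- Insertion into a sorted list, keeping track of the sign of the permutation;
`none` signals a repeated entry. -/
def insertSigned (a : ℕ) : List ℕ → Option (Bool × List ℕ)
  | [] => some (false, [a])
  | b :: l =>
    match Nat.blt a b with
    | true => some (false, a :: b :: l)
    | false =>
      match Nat.beq a b with
      | true => none
      | false =>
        match insertSigned a l with
        | none => none
        | some (s, l') => some (!s, b :: l')

/-- Insertion sort, keeping track of the sign of the permutation;
`none` signals a repeated entry. -/
def sortSigned : List ℕ → Option (Bool × List ℕ)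
  | [] => some (false, [])
  | a :: l =>
    match sortSigned l with
    | none => none
    | some (s, l') =>
      match insertSigned a l' with
      | none => none
      | some (s', l'') => some (xor s s', l'')

/-- The value on `pre ++ l` with a sign, for an optional signed list `l`. -/
def signedVal (G : List ℕ → M) (pre : List ℕ) : Option (Bool × List ℕ) → M
  | none => 0
  | some (s, l) => bif s then -G (pre ++ l) else G (pre ++ l)

/-- Functions on lists that change sign when adjacent entries are interchanged. -/
def SwapAnti (G : List ℕ → M) : Prop :=
  ∀ pre a b suf, G (pre ++ b :: a :: suf) = -G (pre ++ a :: b :: suf)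

variable [Module ℚ M] {G : List ℕ → M}

lemma signedVal_insertSigned (hG : SwapAnti G) (pre : List ℕ) (a : ℕ) (l : List ℕ) :
    signedVal G pre (insertSigned a l) = G (pre ++ a :: l) := by
  induction l generalizing pre with
  | nil => rfl
  | cons b l ih =>
    rw [insertSigned]
    split
    · rfl
    · split
      · next h =>
        obtain rfl := Nat.eq_of_beq_eq_true h
        have := hG pre a a l
        rw [eq_neg_iff_add_eq_zero, ← two_smul ℚ] at this
        exact ((smul_eq_zero.1 this).resolve_left two_ne_zero).symm
      · have h := ih (pre ++ [b])
        have h' := hG pre a b l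
        simp only [List.append_assoc, List.singleton_append] at h
        rw [h'] at h
        rw [← neg_eq_iff_eq_neg] at h
        rw [← h]
        rcases insertSigned a l with - | ⟨s, l'⟩
        · simp [signedVal]
        · cases s <;> simp [signedVal]

lemma signedVal_sortSigned (hG : SwapAnti G) (pre l : List ℕ) :
    signedVal G pre (sortSigned l) = G (pre ++ l) := by
  induction l generalizing pre with
  | nil => rfl
  | cons a l ih =>
    have h := ih (pre ++ [a])
    simp only [List.append_assoc, List.singleton_append] at h
    rw [← h, sortSigned]
    split
    · next h₁ => rw [h₁]; rfl
    · next s₁ l₁ h₁ =>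
      have h₂ := signedVal_insertSigned hG pre a l₁
      rw [h₁]
      have h₃ : signedVal G (pre ++ [a]) (some (s₁, l₁)) =
          bif s₁ then -signedVal G pre (insertSigned a l₁)
            else signedVal G pre (insertSigned a l₁) := by
        rw [h₂]
        simp [signedVal]
      rw [h₃]
      rcases insertSigned a l₁ with - | ⟨s₂, l₂⟩
      · cases s₁ <;> simp [signedVal]
      · cases s₁ <;> cases s₂ <;> simp [signedVal]

end SortingColumns

section Collecting

variable {M : Type*} [AddCommGroup M]

/-- Lexicographic comparison. -/
def lexCompare : List ℕ → List ℕ → Ordering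
  | [], [] => .eq
  | [], _ :: _ => .lt
  | _ :: _, [] => .gt
  | a :: l, b :: l' =>
    match Nat.blt a b with
    | true => .lt
    | false =>
      match Nat.blt b a with
      | true => .gt
      | false => lexCompare l l'

lemma eq_of_lexCompare {l l' : List ℕ} (h : lexCompare l l' = .eq) : l = l' := by
  induction l generalizing l' with
  | nil =>
    cases l' with
    | nil => rfl
    | cons => cases h
  | cons a l ih =>
    cases l' with
    | nil => cases h
    | cons b l' =>
      rw [lexCompare] at h
      split at h
      · cases h
      · split at h
        · cases h
        · next h₁ _ h₂ =>
          have h₁' : ¬a < b := fun hlt => by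
            rw [← Nat.blt_eq, h₁] at hlt
            cases hlt
          have h₂' : ¬b < a := fun hlt => by
            rw [← Nat.blt_eq, h₂] at hlt
            cases hlt
          rw [ih h, le_antisymm (not_lt.1 h₂') (not_lt.1 h₁')]

/-- Binary search trees of integer coefficients indexed by lists. -/
inductive CoeffTree : Type
  | leaf : CoeffTree
  | node : CoeffTree → ℤ → List ℕ → CoeffTree → CoeffTree

/-- Adding a term to a tree. -/
def CoeffTree.insert (c : ℤ) (w : List ℕ) : CoeffTree → CoeffTree
  | .leaf => .node .leaf c w .leaf
  | .node l c' w' r =>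
    match lexCompare w w' with
    | .lt => .node (l.insert c w) c' w' r
    | .eq => .node l (c + c') w' r
    | .gt => .node l c' w' (r.insert c w)

/-- Whether all coefficients of a tree vanish. -/
def CoeffTree.isZero : CoeffTree → Bool
  | .leaf => true
  | .node l c _ r =>
    match c with
    | .ofNat n => Nat.beq n 0 && (l.isZero && r.isZero)
    | .negSucc _ => false

/-- The linear combination stored in a tree. -/
def CoeffTree.val (G : List ℕ → M) : CoeffTree → M
  | .leaf => 0
  | .node l c w r => l.val G + c • G w + r.val G

lemma CoeffTree.val_insert (G : List ℕ → M) (c : ℤ) (w : List ℕ) (t : CoeffTree) :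
    (t.insert c w).val G = t.val G + c • G w := by
  induction t with
  | leaf => simp [CoeffTree.insert, CoeffTree.val]
  | node l c' w' r hl hr =>
    rw [CoeffTree.insert]
    split
    · simp only [CoeffTree.val, hl]
      abel
    · next h =>
      simp only [CoeffTree.val, eq_of_lexCompare h, add_smul]
      abel
    · simp only [CoeffTree.val, hr]
      abel

lemma CoeffTree.val_eq_zero (G : List ℕ → M) {t : CoeffTree} (h : t.isZero = true) :
    t.val G = 0 := by
  induction t with
  | leaf => rfl
  | node l c w r hl hr =>
    cases c with
    | ofNat n =>
      simp only [CoeffTree.isZero, Bool.and_eq_true] at h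
      obtain rfl := Nat.eq_of_beq_eq_true h.1
      simp [CoeffTree.val, hl h.2.1, hr h.2.2]
    | negSucc n => cases h

end Collecting

section Words

/-- The `i`-th digit of `c` in base 8. -/
def digit (i c : ℕ) : ℕ := c / 8 ^ i % 8

/-- The number with base 8 digits `a, b, c, d` (taken mod 8), in increasing order of weight. -/
def column (a b c d : ℕ) : ℕ := a % 8 + 8 * (b % 8 + 8 * (c % 8 + 8 * (d % 8)))

lemma digit_lt (i c : ℕ) : digit i c < 8 := Nat.mod_lt _ (by norm_num)

lemma digit_column_zero (a b c d : ℕ) : digit 0 (column a b c d) = a % 8 := by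
  simp only [digit, column]
  omega

lemma digit_column_one (a b c d : ℕ) : digit 1 (column a b c d) = b % 8 := by
  simp only [digit, column]
  omega

lemma digit_column_two (a b c d : ℕ) : digit 2 (column a b c d) = c % 8 := by
  simp only [digit, column]
  omega

lemma digit_column_three (a b c d : ℕ) : digit 3 (column a b c d) = d % 8 := by
  simp only [digit, column]
  omega

/-- A word is a list of eight columns of four colours each; its `i`-th row is a letter. -/
noncomputable def row (w : List ℕ) (i : ℕ) : VF K4 := letter fun k => digit i (w.getD k 0)

lemma swap_apply_getD (pre : List ℕ) (a b : ℕ) (suf : List ℕ) (k : ℕ) :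
    (pre ++ b :: a :: suf).getD k 0 =
      (pre ++ a :: b :: suf).getD (if k = pre.length then pre.length + 1 else
        if k = pre.length + 1 then pre.length else k) 0 := by
  induction pre generalizing k with
  | nil =>
    rcases k with - | - | k <;> simp
  | cons x pre ih =>
    rcases k with - | k
    · simp
    · have := ih k
      simp only [List.cons_append, List.getD_cons_succ, List.length_cons, Nat.add_right_cancel_iff]
      rw [this]
      split_ifs <;> simp

lemma row_swap {pre : List ℕ} {a b : ℕ} {suf : List ℕ} (h : (pre ++ a :: b :: suf).length = 8) :
    ∃ σ : Equiv.Perm (Fin 8), Equiv.Perm.sign σ = -1 ∧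
      ∀ i, row (pre ++ b :: a :: suf) i = vmap (permAut 8 4 σ) (row (pre ++ a :: b :: suf) i) := by
  have hp : pre.length + 1 < 8 := by
    simp only [List.length_append, List.length_cons] at h
    omega
  refine ⟨Equiv.swap ⟨pre.length, by omega⟩ ⟨pre.length + 1, hp⟩,
    Equiv.Perm.sign_swap (by simp), fun i => ?_⟩
  rw [row, row, vmap_letter]
  congr 1
  ext k
  rw [swap_apply_getD, Equiv.swap_inv, Equiv.swap_apply_def]
  simp only [Fin.ext_iff]
  split_ifs <;> rfl

/-- Applying a map to the entries of each column of a word. -/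
def recolor (g : ℕ → ℕ) (w : List ℕ) : List ℕ :=
  w.map fun c => column (g (digit 0 c)) (g (digit 1 c)) (g (digit 2 c)) (g (digit 3 c))

/-- Permuting the rows of a word. -/
def permuteRows (i j k l : ℕ) (w : List ℕ) : List ℕ :=
  w.map fun c => column (digit i c) (digit j c) (digit k c) (digit l c)

lemma getD_map_of_zero {g : ℕ → ℕ} (hg : g 0 = 0) (w : List ℕ) (k : ℕ) :
    (w.map g).getD k 0 = g (w.getD k 0) := by
  rw [← hg, List.getD_map, hg]

lemma getD_permuteRows (i j k l : ℕ) (w : List ℕ) (m : ℕ) :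
    (permuteRows i j k l w).getD m 0 = column (digit i (w.getD m 0)) (digit j (w.getD m 0))
      (digit k (w.getD m 0)) (digit l (w.getD m 0)) := by
  rw [permuteRows, getD_map_of_zero]
  simp [digit, column]

lemma getD_recolor {g : ℕ → ℕ} (hg : g 0 = 0) (w : List ℕ) (m : ℕ) :
    (recolor g w).getD m 0 = column (g (digit 0 (w.getD m 0))) (g (digit 1 (w.getD m 0)))
      (g (digit 2 (w.getD m 0))) (g (digit 3 (w.getD m 0))) := by
  rw [recolor, getD_map_of_zero]
  simp [digit, column, hg]

lemma digit_mod (i c : ℕ) : digit i c % 8 = digit i c := Nat.mod_eq_of_lt (digit_lt i c)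

/-- Interchanging two of the colours of the pairs of points in `conc 3 1 2 4 5 7 8`. -/
def swapColors (a b c : ℕ) : ℕ :=
  bif Nat.beq c a then b else bif Nat.beq c b then a else c

lemma letter_swap_two_three (c : Fin 8 → ℕ) :
    letter (fun k => swapColors 2 3 (c k)) = letter c := by
  refine letter_recolor (fun n => ?_)
    ![1, Equiv.swap 0 3 * Equiv.swap 1 4, 1] (fun t k => ?_) (fun t => ?_) c
  · rcases n with - | - | - | - | n <;> rfl
  · fin_cases t <;> fin_cases k <;> rfl
  · fin_cases t
    · rfl
    · exact (congrArg cls (conc_swap₁₂ 2 0 1 3 4 6 7)).trans (cls_neg _)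
    · rfl

lemma letter_swap_three_four (c : Fin 8 → ℕ) :
    letter (fun k => swapColors 3 4 (c k)) = letter c := by
  refine letter_recolor (fun n => ?_)
    ![1, Equiv.swap 3 6 * Equiv.swap 4 7, 1] (fun t k => ?_) (fun t => ?_) c
  · rcases n with - | - | - | - | - | n <;> rfl
  · fin_cases t <;> fin_cases k <;> rfl
  · fin_cases t
    · rfl
    · exact (congrArg cls (conc_swap₂₃ 2 0 1 3 4 6 7)).trans (cls_neg _)
    · rfl

lemma row_recolor {g : ℕ → ℕ} (h0 : g 0 = 0) (hlt : ∀ n < 8, g n < 8)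
    (hg : ∀ c : Fin 8 → ℕ, letter (fun k => g (c k)) = letter c) (w : List ℕ) {i : ℕ} (hi : i < 4) :
    row (recolor g w) i = row w i := by
  rw [row, row, ← hg fun k => digit i (w.getD k 0)]
  congr 1
  ext k
  have h (j) : g (digit j (w.getD k 0)) % 8 = g (digit j (w.getD k 0)) :=
    Nat.mod_eq_of_lt (hlt _ (digit_lt _ _))
  rw [getD_recolor h0]
  interval_cases i
  · rw [digit_column_zero, h]
  · rw [digit_column_one, h]
  · rw [digit_column_two, h]
  · rw [digit_column_three, h]

lemma swapColors_lt {a b : ℕ} (ha : a < 8) (hb : b < 8) (n : ℕ) (hn : n < 8) :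
    swapColors a b n < 8 := by
  rw [swapColors]
  cases Nat.beq n a <;> cases Nat.beq n b <;> simpa

variable {M : Type*} [Zero M]

/-- The value of a function of four classes on the rows of a word
(and `0` if the number of columns is not eight). -/
noncomputable def wordVal (f : VF K4 → VF K4 → VF K4 → VF K4 → M) (w : List ℕ) : M :=
  if w.length = 8 then f (row w 0) (row w 1) (row w 2) (row w 3) else 0

lemma length_recolor (g : ℕ → ℕ) (w : List ℕ) : (recolor g w).length = w.length :=
  List.length_map _

lemma wordVal_recolor (f : VF K4 → VF K4 → VF K4 → VF K4 → M) {g : ℕ → ℕ} (h0 : g 0 = 0)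
    (hlt : ∀ n < 8, g n < 8) (hg : ∀ c : Fin 8 → ℕ, letter (fun k => g (c k)) = letter c)
    (w : List ℕ) : wordVal f (recolor g w) = wordVal f w := by
  rw [wordVal, wordVal, length_recolor, row_recolor h0 hlt hg w (by norm_num),
    row_recolor h0 hlt hg w (by norm_num),
    row_recolor h0 hlt hg w (by norm_num), row_recolor h0 hlt hg w (by norm_num)]

lemma wordVal_swap_two_three (f : VF K4 → VF K4 → VF K4 → VF K4 → M) (w : List ℕ) :
    wordVal f (recolor (swapColors 2 3) w) = wordVal f w :=
  wordVal_recolor f rfl (swapColors_lt (by norm_num) (by norm_num)) letter_swap_two_three w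

lemma wordVal_swap_three_four (f : VF K4 → VF K4 → VF K4 → VF K4 → M) (w : List ℕ) :
    wordVal f (recolor (swapColors 3 4) w) = wordVal f w :=
  wordVal_recolor f rfl (swapColors_lt (by norm_num) (by norm_num)) letter_swap_three_four w

end Words

section SkewFunctions

variable {M : Type*} [AddCommGroup M]

/-- Additive functions of four classes that are skew under permutations of the vectors. -/
structure IsSkew (f : VF K4 → VF K4 → VF K4 → VF K4 → M) : Prop where
  add₁ : ∀ a a' b c d, f (a + a') b c d = f a b c d + f a' b c d
  add₂ : ∀ a b b' c d, f a (b + b') c d = f a b c d + f a b' c d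
  add₃ : ∀ a b c c' d, f a b (c + c') d = f a b c d + f a b c' d
  add₄ : ∀ a b c d d', f a b c (d + d') = f a b c d + f a b c d'
  vmap : ∀ (σ : Equiv.Perm (Fin 8)) a b c d,
    f (vmap (permAut 8 4 σ) a) (vmap (permAut 8 4 σ) b) (vmap (permAut 8 4 σ) c)
      (vmap (permAut 8 4 σ) d) = ((Equiv.Perm.sign σ : ℤˣ) : ℤ) • f a b c d

variable {f : VF K4 → VF K4 → VF K4 → VF K4 → M}

lemma IsSkew.swapAnti (hf : IsSkew f) : SwapAnti (wordVal f) := by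
  intro pre a b suf
  have hl : (pre ++ b :: a :: suf).length = (pre ++ a :: b :: suf).length := by simp
  by_cases h : (pre ++ a :: b :: suf).length = 8
  · obtain ⟨σ, hσ, hr⟩ := row_swap h
    rw [wordVal, wordVal, hl, if_pos h, if_pos h, hr, hr, hr, hr, hf.vmap, hσ]
    simp
  · rw [wordVal, wordVal, hl, if_neg h, if_neg h, neg_zero]

/-- Choose the smaller of two signed lists. -/
def minSigned : Option (Bool × List ℕ) → Option (Bool × List ℕ) → Option (Bool × List ℕ)
  | none, _ => none
  | some _, none => none
  | some (s, l), some (s', l') =>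
    match lexCompare l l' with
    | .lt => some (s, l)
    | .eq => some (s, l)
    | .gt => some (s', l')

lemma signedVal_minSigned {G : List ℕ → M} {x y : Option (Bool × List ℕ)} {m : M}
    (hx : signedVal G [] x = m) (hy : signedVal G [] y = m) :
    signedVal G [] (minSigned x y) = m := by
  rcases x with - | ⟨s, l⟩
  · exact hx
  · rcases y with - | ⟨s', l'⟩
    · exact hy
    · rw [minSigned]
      split
      exacts [hx, hx, hy]

/-- Whether one of the colours of the columns of a word is 2. -/
def hasPairColor : List ℕ → Bool
  | [] => false
  | c :: w =>
    Nat.beq (digit 0 c) 2 || (Nat.beq (digit 1 c) 2 || (Nat.beq (digit 2 c) 2 ||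
      (Nat.beq (digit 3 c) 2 || hasPairColor w)))

/-- The canonical form of a word under permutations of columns and of the colours 2, 3, 4. -/
def canonical (w : List ℕ) : Option (Bool × List ℕ) :=
  match sortSigned w with
  | none => none
  | some (s, w') =>
    bif hasPairColor w' then
      let a := recolor (swapColors 2 3)
      let b := recolor (swapColors 3 4)
      minSigned (some (s, w')) <| minSigned (sortSigned (a w)) <|
        minSigned (sortSigned (b w)) <| minSigned (sortSigned (b (a w))) <|
          minSigned (sortSigned (a (b w))) (sortSigned (a (b (a w))))
    else some (s, w')

lemma IsSkew.signedVal_sortSigned [Module ℚ M] (hf : IsSkew f) (w : List ℕ) :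
    signedVal (wordVal f) [] (sortSigned w) = wordVal f w :=
  GrassPoly.signedVal_sortSigned hf.swapAnti [] w

lemma IsSkew.signedVal_canonical [Module ℚ M] (hf : IsSkew f) (w : List ℕ) :
    signedVal (wordVal f) [] (canonical w) = wordVal f w := by
  have h := hf.signedVal_sortSigned w
  rw [canonical]
  split
  · next h₁ => rwa [h₁] at h
  · next s w' h₁ =>
    rw [h₁] at h
    cases hasPairColor w'
    · exact h
    · refine signedVal_minSigned h <| signedVal_minSigned ?_ <| signedVal_minSigned ?_ <|
        signedVal_minSigned ?_ <| signedVal_minSigned ?_ ?_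
      all_goals
        simp only [hf.signedVal_sortSigned, wordVal_swap_two_three, wordVal_swap_three_four]

end SkewFunctions

section Combinations

/-- Splice four colourings into a word. -/
def spliceRows : List ℕ → List ℕ → List ℕ → List ℕ → List ℕ
  | a :: as, b :: bs, c :: cs, d :: ds => column a b c d :: spliceRows as bs cs ds
  | _, _, _, _ => []

lemma getD_spliceRows {a b c d : List ℕ} (hb : b.length = a.length) (hc : c.length = a.length)
    (hd : d.length = a.length) (k : ℕ) : (spliceRows a b c d).getD k 0 =
      column (a.getD k 0) (b.getD k 0) (c.getD k 0) (d.getD k 0) := by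
  induction a generalizing b c d k with
  | nil =>
    rw [List.length_nil, List.length_eq_zero_iff] at hb hc hd
    subst hb hc hd
    simp [spliceRows, column]
  | cons x a ih =>
    rcases b with - | ⟨y, b⟩
    · cases hb
    rcases c with - | ⟨z, c⟩
    · cases hc
    rcases d with - | ⟨t, d⟩
    · cases hd
    rcases k with - | k
    · rfl
    · exact ih (Nat.succ_injective hb) (Nat.succ_injective hc) (Nat.succ_injective hd) k

lemma length_spliceRows {a b c d : List ℕ} (hb : b.length = a.length) (hc : c.length = a.length)
    (hd : d.length = a.length) : (spliceRows a b c d).length = a.length := by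
  induction a generalizing b c d with
  | nil => rw [spliceRows]; simp
  | cons x a ih =>
    rcases b with - | ⟨y, b⟩
    · cases hb
    rcases c with - | ⟨z, c⟩
    · cases hc
    rcases d with - | ⟨t, d⟩
    · cases hd
    exact congrArg (· + 1) (ih (Nat.succ_injective hb) (Nat.succ_injective hc)
      (Nat.succ_injective hd))

/-- The class given by an integral combination of colourings. -/
noncomputable def combVal (V : List (ℤ × List ℕ)) : VF K4 :=
  (V.map fun p => p.1 • letter fun k => p.2.getD k 0 % 8).sum

/-- All colourings in a combination are colourings of eight points. -/
def LengthEight (V : List (ℤ × List ℕ)) : Prop := ∀ p ∈ V, p.2.length = 8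

/-- The tensor product of four combinations, as a combination of words. -/
def spliceCombs (A B C D : List (ℤ × List ℕ)) : List (ℤ × List ℕ) :=
  A.flatMap fun a => B.flatMap fun b => C.flatMap fun c => D.map fun d =>
    (a.1 * b.1 * c.1 * d.1, spliceRows a.2 b.2 c.2 d.2)

variable {M : Type*} [AddCommGroup M]

/-- The value of a combination of words. -/
noncomputable def wordsVal (f : VF K4 → VF K4 → VF K4 → VF K4 → M) (E : List (ℤ × List ℕ)) : M :=
  (E.map fun p => p.1 • wordVal f p.2).sum

lemma wordsVal_append (f : VF K4 → VF K4 → VF K4 → VF K4 → M) (E E' : List (ℤ × List ℕ)) :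
    wordsVal f (E ++ E') = wordsVal f E + wordsVal f E' := by
  simp [wordsVal]

lemma wordsVal_flatMap {α : Type*} (f : VF K4 → VF K4 → VF K4 → VF K4 → M)
    (E : α → List (ℤ × List ℕ)) (V : List α) :
    wordsVal f (V.flatMap E) = (V.map fun a => wordsVal f (E a)).sum := by
  induction V with
  | nil => rfl
  | cons a V ih => rw [List.flatMap_cons, wordsVal_append, ih, List.map_cons, List.sum_cons]

lemma map_combVal (g : VF K4 →+ M) (V : List (ℤ × List ℕ)) :
    g (combVal V) = (V.map fun p => p.1 • g (letter fun k => p.2.getD k 0 % 8)).sum := by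
  rw [combVal, map_list_sum, List.map_map]
  simp [Function.comp_def]

variable {f : VF K4 → VF K4 → VF K4 → VF K4 → M}

lemma IsSkew.wordsVal_spliceCombs (hf : IsSkew f) {A B C D : List (ℤ × List ℕ)}
    (hA : LengthEight A) (hB : LengthEight B) (hC : LengthEight C) (hD : LengthEight D) :
    wordsVal f (spliceCombs A B C D) = f (combVal A) (combVal B) (combVal C) (combVal D) := by
  have h₁ (b c d) := map_combVal (AddMonoidHom.mk' (fun a => f a b c d)
    fun a a' => hf.add₁ a a' b c d) A
  have h₂ (a c d) := map_combVal (AddMonoidHom.mk' (fun b => f a b c d)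
    fun b b' => hf.add₂ a b b' c d) B
  have h₃ (a b d) := map_combVal (AddMonoidHom.mk' (fun c => f a b c d)
    fun c c' => hf.add₃ a b c c' d) C
  have h₄ (a b c) := map_combVal (AddMonoidHom.mk' (fun d => f a b c d)
    fun d d' => hf.add₄ a b c d d') D
  simp only [AddMonoidHom.mk'_apply] at h₁ h₂ h₃ h₄
  simp only [h₁, h₂, h₃, h₄, spliceCombs, wordsVal_flatMap, List.smul_sum, List.map_map,
    Function.comp_def, smul_smul]
  refine congrArg List.sum (List.map_congr_left fun a ha => congrArg List.sum
    (List.map_congr_left fun b hb => congrArg List.sum (List.map_congr_left fun c hc => ?_)))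
  simp only [wordsVal, List.map_map, Function.comp_def]
  refine congrArg List.sum (List.map_congr_left fun d hd => ?_)
  have hg := getD_spliceRows (a := a.2) (b := b.2) (c := c.2) (d := d.2)
    (by simp only [hA a ha, hB b hb]) (by simp only [hA a ha, hC c hc])
    (by simp only [hA a ha, hD d hd])
  rw [wordVal, if_pos ((length_spliceRows (by simp only [hA a ha, hB b hb])
    (by simp only [hA a ha, hC c hc]) (by simp only [hA a ha, hD d hd])).trans (hA a ha))]
  simp only [row, hg, digit_column_zero, digit_column_one, digit_column_two,
    digit_column_three, mul_assoc]

end Combinations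

section Certificate

/-- The terms of `Π̃₄`, given by a sign and a permutation of the rows. -/
def pitTerms : List (Bool × ℕ × ℕ × ℕ × ℕ) :=
  [(false, 0, 1, 2, 3), (true, 1, 0, 2, 3), (true, 1, 2, 0, 3), (false, 2, 1, 0, 3),
    (true, 1, 2, 3, 0), (false, 2, 1, 3, 0), (false, 2, 3, 1, 0), (true, 3, 2, 1, 0)]

/-- Negate an integer if a sign is set. -/
def applySign (s : Bool) (c : ℤ) : ℤ := bif s then -c else c

/-- Add the canonical form of a word to a tree. -/
def addCanonical (c : ℤ) (w : List ℕ) (t : CoeffTree) : CoeffTree :=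
  match canonical w with
  | none => t
  | some (s, v) => t.insert (applySign s c) v

/-- Collect a combination of words in a tree. -/
def collect (E : List (ℤ × List ℕ)) : CoeffTree :=
  E.foldr (fun p t => addCanonical p.1 p.2 t) .leaf

/-- Add the canonical forms of the terms of `Π̃₄` of a word to a tree. -/
def addPit (c : ℤ) (w : List ℕ) (t : CoeffTree) : CoeffTree :=
  pitTerms.foldr (fun p t => addCanonical (applySign p.1 c)
    (permuteRows p.2.1 p.2.2.1 p.2.2.2.1 p.2.2.2.2 w) t) t

/-- Add `Π̃₄` of the combination stored in a tree to another tree. -/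
def addTree : CoeffTree → CoeffTree → CoeffTree
  | .leaf, t => t
  | .node l c w r, t =>
    match c with
    | .ofNat 0 => addTree l (addTree r t)
    | c => addTree l (addPit c w (addTree r t))

/-- Whether the skew-symmetrization of `Π̃₄` of a combination of words vanishes formally. -/
def checkWords (E : List (ℤ × List ℕ)) : Bool := (addTree (collect E) .leaf).isZero

/-- `ρ₁ρ₃₂/(ρ₁₂ρ₃₄)`. -/
def combZ : List (ℤ × List ℕ) :=
  [(1, [1, 1, 1, 0, 0, 0, 1, 0]), (1, [0, 1, 1, 1, 1, 0, 0, 0]), (1, [0, 0, 1, 1, 0, 0, 1, 1]),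
    (1, [0, 0, 0, 1, 1, 1, 0, 1]), (-1, [1, 1, 1, 1, 0, 0, 0, 0]), (-1, [0, 1, 1, 0, 0, 0, 1, 1]),
    (-1, [0, 0, 1, 1, 1, 1, 0, 0]), (-1, [0, 0, 0, 1, 1, 0, 1, 1])]

/-- `ρ₁₂ρ₃₄/(ρ₂₃ρ₁₄)`. -/
def combX₁ : List (ℤ × List ℕ) :=
  [(1, [1, 1, 1, 1, 0, 0, 0, 0]), (1, [0, 1, 1, 0, 0, 0, 1, 1]), (1, [0, 0, 1, 1, 1, 1, 0, 0]),
    (1, [0, 0, 0, 1, 1, 0, 1, 1]), (-1, [0, 1, 1, 1, 1, 0, 0, 0]), (-1, [0, 0, 1, 1, 0, 0, 1, 1]),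
    (-1, [5, 5, 5, 6, 6, 6, 7, 7])]

/-- `ρ₁₃ρ₂₄/(ρ₁₂ρ₃₄)`. -/
def combA₁ : List (ℤ × List ℕ) :=
  [(1, [2, 2, 5, 3, 3, 6, 4, 4]), (1, [6, 2, 2, 5, 3, 3, 4, 4]), (-1, [1, 1, 1, 1, 0, 0, 0, 0]),
    (-1, [0, 1, 1, 0, 0, 0, 1, 1]), (-1, [0, 0, 1, 1, 1, 1, 0, 0]), (-1, [0, 0, 0, 1, 1, 0, 1, 1])]

/-- `ρ₄/ρ₁`. -/
def combB₁ : List (ℤ × List ℕ) :=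
  [(1, [0, 0, 0, 1, 1, 1, 1, 0]), (-1, [0, 0, 0, 1, 1, 1, 0, 1]), (-1, [1, 1, 1, 0, 0, 0, 1, 0]),
    (1, [1, 1, 1, 0, 0, 0, 0, 1])]

/-- `ρ₄ρ₃₂/(ρ₁₂ρ₃₄)`. -/
def combC₁ : List (ℤ × List ℕ) :=
  [(1, [0, 0, 0, 1, 1, 1, 1, 0]), (1, [1, 1, 1, 0, 0, 0, 0, 1]), (1, [0, 1, 1, 1, 1, 0, 0, 0]),
    (1, [0, 0, 1, 1, 0, 0, 1, 1]), (-1, [1, 1, 1, 1, 0, 0, 0, 0]), (-1, [0, 1, 1, 0, 0, 0, 1, 1]),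
    (-1, [0, 0, 1, 1, 1, 1, 0, 0]), (-1, [0, 0, 0, 1, 1, 0, 1, 1])]

/-- `ρ₁₂/ρ₁`. -/
def combX₂ : List (ℤ × List ℕ) :=
  [(1, [1, 1, 1, 1, 0, 0, 0, 0]), (1, [0, 1, 1, 0, 0, 0, 1, 1]), (-1, [0, 1, 1, 1, 0, 0, 0, 1]),
    (-1, [1, 1, 1, 0, 0, 0, 1, 0])]

/-- `ρ₂/ρ₁₂`. -/
def combA₂ : List (ℤ × List ℕ) :=
  [(1, [0, 1, 1, 1, 0, 0, 1, 0]), (-1, [1, 1, 1, 1, 0, 0, 0, 0]), (-1, [0, 1, 1, 0, 0, 0, 1, 1]),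
    (1, [1, 1, 1, 0, 0, 0, 0, 1])]

/-- `ρ₂₄/ρ₂₃`. -/
def combB₂ : List (ℤ × List ℕ) :=
  [(1, [6, 2, 2, 5, 3, 3, 4, 4]), (-1, [0, 0, 0, 1, 1, 1, 0, 1]), (-1, [0, 1, 1, 1, 1, 0, 0, 0]),
    (-1, [0, 0, 1, 1, 0, 0, 1, 1]), (1, [0, 0, 1, 1, 1, 0, 0, 1])]

/-- `ρ₁ρ₂₄/(ρ₁₂ρ₃₄)`. -/
def combC₂ : List (ℤ × List ℕ) :=
  [(1, [6, 2, 2, 5, 3, 3, 4, 4]), (1, [0, 0, 1, 1, 1, 0, 0, 1]), (1, [1, 1, 1, 0, 0, 0, 1, 0]),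
    (-1, [1, 1, 1, 1, 0, 0, 0, 0]), (-1, [0, 1, 1, 0, 0, 0, 1, 1]), (-1, [0, 0, 1, 1, 1, 1, 0, 0]),
    (-1, [0, 0, 0, 1, 1, 0, 1, 1])]

/-- Multiply a combination by an integer. -/
def scaleWords (n : ℤ) (E : List (ℤ × List ℕ)) : List (ℤ × List ℕ) :=
  E.map fun p => (n * p.1, p.2)

/-- The words in the part of `S I_{3,1}` without the factor `[1 - z]`. -/
def tripleWords (A B C X : List (ℤ × List ℕ)) : List (ℤ × List ℕ) :=
  spliceCombs A C combZ combZ ++ (scaleWords (-1) (spliceCombs A X B combZ) ++ spliceCombs A X X B)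

/-- The difference of the two sides of the identity. -/
def allWords : List (ℤ × List ℕ) :=
  tripleWords combA₁ combB₁ combC₁ combX₁ ++
    (scaleWords 2 (tripleWords combA₂ combB₂ combC₂ combX₂) ++
    scaleWords (-56) (spliceCombs [(1, [1, 1, 1, 1, 0, 0, 0, 0])] [(1, [0, 1, 1, 1, 1, 0, 0, 0])]
      [(1, [0, 0, 1, 1, 1, 1, 0, 0])] [(1, [0, 0, 0, 1, 1, 1, 1, 0])]))

set_option maxRecDepth 100000 in
attribute [local instance] instDecidableEqBool in
lemma checkWords_allWords : checkWords allWords = true := by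
  decide +kernel

end Certificate

section Soundness

section Generic

variable {F : Type} [Field F]

lemma tprod_add_one (a a' b c d : VF F) :
    tprod ℚ ![a + a', b, c, d] = tprod ℚ ![a, b, c, d] + tprod ℚ ![a', b, c, d] := by
  have h (x : VF F) : ![x, b, c, d] = Function.update ![a, b, c, d] 0 x := by
    ext i
    fin_cases i <;> simp
  rw [h, MultilinearMap.map_update_add, ← h, ← h]

lemma tprod_add_two (a b b' c d : VF F) :
    tprod ℚ ![a, b + b', c, d] = tprod ℚ ![a, b, c, d] + tprod ℚ ![a, b', c, d] := by
  have h (x : VF F) : ![a, x, c, d] = Function.update ![a, b, c, d] 1 x := by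
    ext i
    fin_cases i <;> simp
  rw [h, MultilinearMap.map_update_add, ← h, ← h]

lemma tprod_add_three (a b c c' d : VF F) :
    tprod ℚ ![a, b, c + c', d] = tprod ℚ ![a, b, c, d] + tprod ℚ ![a, b, c', d] := by
  have h (x : VF F) : ![a, b, x, d] = Function.update ![a, b, c, d] 2 x := by
    ext i
    fin_cases i <;> simp
  rw [h, MultilinearMap.map_update_add, ← h, ← h]

lemma tprod_add_four (a b c d d' : VF F) :
    tprod ℚ ![a, b, c, d + d'] = tprod ℚ ![a, b, c, d] + tprod ℚ ![a, b, c, d'] := by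
  have h (x : VF F) : ![a, b, c, x] = Function.update ![a, b, c, d] 3 x := by
    ext i
    fin_cases i <;> simp
  rw [h, MultilinearMap.map_update_add, ← h, ← h]

lemma tpMap_tprod_four (φ : F ≃+* F) (a b c d : VF F) :
    tpMap φ (tprod ℚ ![a, b, c, d]) =
      tprod ℚ ![vmap φ a, vmap φ b, vmap φ c, vmap φ d] := by
  rw [tpMap_tprod]
  congr 1
  ext i
  fin_cases i <;> rfl

variable (N m : ℕ)

/-- The skew-symmetrization of a tensor. -/
noncomputable def altTensor (a b c d : VF (FF N m)) : TP (FF N m) 4 :=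
  altL N m 4 (tprod ℚ ![a, b, c, d])

/-- The skew-symmetrization of `Π̃₄` of a tensor. -/
noncomputable def altPit (a b c d : VF (FF N m)) : TP (FF N m) 4 :=
  altL N m 4 (Pit 4 (tprod ℚ ![a, b, c, d]))

variable {N m}

lemma altTensor_vmap (σ : Equiv.Perm (Fin N)) (a b c d : VF (FF N m)) :
    altTensor N m (vmap (permAut N m σ) a) (vmap (permAut N m σ) b) (vmap (permAut N m σ) c)
      (vmap (permAut N m σ) d) = ((Equiv.Perm.sign σ : ℤˣ) : ℤ) • altTensor N m a b c d := by
  rw [altTensor, ← tpMap_tprod_four, altL_tpMap, Int.cast_smul_eq_zsmul, altTensor]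

lemma altPit_vmap (σ : Equiv.Perm (Fin N)) (a b c d : VF (FF N m)) :
    altPit N m (vmap (permAut N m σ) a) (vmap (permAut N m σ) b) (vmap (permAut N m σ) c)
      (vmap (permAut N m σ) d) = ((Equiv.Perm.sign σ : ℤˣ) : ℤ) • altPit N m a b c d := by
  rw [altPit, ← tpMap_tprod_four, Pit_four_tpMap, altL_tpMap, Int.cast_smul_eq_zsmul, altPit]

lemma altPit_eq (a b c d : VF (FF N m)) :
    altPit N m a b c d =
      altTensor N m a b c d - altTensor N m b a c d
        - (altTensor N m b c a d - altTensor N m c b a d)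
        - (altTensor N m b c d a - altTensor N m c b d a
          - (altTensor N m c d b a - altTensor N m d c b a)) := by
  simp only [altPit, altTensor, Pit_four_tprod, map_sub]

lemma altTensor_add_one (a a' b c d : VF (FF N m)) :
    altTensor N m (a + a') b c d = altTensor N m a b c d + altTensor N m a' b c d := by
  rw [altTensor, tprod_add_one, map_add, altTensor, altTensor]

lemma altTensor_add_two (a b b' c d : VF (FF N m)) :
    altTensor N m a (b + b') c d = altTensor N m a b c d + altTensor N m a b' c d := by
  rw [altTensor, tprod_add_two, map_add, altTensor, altTensor]

lemma altTensor_add_three (a b c c' d : VF (FF N m)) :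
    altTensor N m a b (c + c') d = altTensor N m a b c d + altTensor N m a b c' d := by
  rw [altTensor, tprod_add_three, map_add, altTensor, altTensor]

lemma altTensor_add_four (a b c d d' : VF (FF N m)) :
    altTensor N m a b c (d + d') = altTensor N m a b c d + altTensor N m a b c d' := by
  rw [altTensor, tprod_add_four, map_add, altTensor, altTensor]

lemma altPit_add_one (a a' b c d : VF (FF N m)) :
    altPit N m (a + a') b c d = altPit N m a b c d + altPit N m a' b c d := by
  rw [altPit, tprod_add_one, map_add, map_add, altPit, altPit]

lemma altPit_add_two (a b b' c d : VF (FF N m)) :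
    altPit N m a (b + b') c d = altPit N m a b c d + altPit N m a b' c d := by
  rw [altPit, tprod_add_two, map_add, map_add, altPit, altPit]

lemma altPit_add_three (a b c c' d : VF (FF N m)) :
    altPit N m a b (c + c') d = altPit N m a b c d + altPit N m a b c' d := by
  rw [altPit, tprod_add_three, map_add, map_add, altPit, altPit]

lemma altPit_add_four (a b c d d' : VF (FF N m)) :
    altPit N m a b c (d + d') = altPit N m a b c d + altPit N m a b c d' := by
  rw [altPit, tprod_add_four, map_add, map_add, altPit, altPit]

end Generic

lemma isSkew_altTensor : IsSkew (altTensor 8 4) where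
  add₁ := altTensor_add_one
  add₂ := altTensor_add_two
  add₃ := altTensor_add_three
  add₄ := altTensor_add_four
  vmap := altTensor_vmap

lemma isSkew_altPit : IsSkew (altPit 8 4) where
  add₁ := altPit_add_one
  add₂ := altPit_add_two
  add₃ := altPit_add_three
  add₄ := altPit_add_four
  vmap := altPit_vmap

lemma row_permuteRows (w : List ℕ) (i j k l : ℕ) :
    row (permuteRows i j k l w) 0 = row w i ∧ row (permuteRows i j k l w) 1 = row w j ∧
      row (permuteRows i j k l w) 2 = row w k ∧ row (permuteRows i j k l w) 3 = row w l := by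
  simp only [row, getD_permuteRows, digit_column_zero, digit_column_one, digit_column_two,
    digit_column_three, digit_mod, and_self]

lemma wordVal_permuteRows {M : Type*} [Zero M] (f : VF K4 → VF K4 → VF K4 → VF K4 → M)
    {w : List ℕ} (h : w.length = 8) (i j k l : ℕ) :
    wordVal f (permuteRows i j k l w) = f (row w i) (row w j) (row w k) (row w l) := by
  obtain ⟨h₀, h₁, h₂, h₃⟩ := row_permuteRows w i j k l
  rw [wordVal, permuteRows, List.length_map, if_pos h, ← permuteRows, h₀, h₁, h₂, h₃]

lemma applySign_smul {M : Type*} [AddCommGroup M] (s : Bool) (c : ℤ) (x : M) :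
    applySign s c • x = c • bif s then -x else x := by
  cases s <;> simp [applySign]

lemma IsSkew.val_addCanonical {M : Type*} [AddCommGroup M] [Module ℚ M]
    {f : VF K4 → VF K4 → VF K4 → VF K4 → M} (hf : IsSkew f) (c : ℤ) (w : List ℕ) (t : CoeffTree) :
    (addCanonical c w t).val (wordVal f) = t.val (wordVal f) + c • wordVal f w := by
  have h := hf.signedVal_canonical w
  rw [addCanonical]
  split
  · next h₁ =>
    rw [h₁] at h
    rw [← h, signedVal, smul_zero, add_zero]
  · next s w' h₁ =>
    rw [h₁] at h
    rw [CoeffTree.val_insert, applySign_smul, ← h]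
    rfl

lemma IsSkew.val_collect {M : Type*} [AddCommGroup M] [Module ℚ M]
    {f : VF K4 → VF K4 → VF K4 → VF K4 → M} (hf : IsSkew f) (E : List (ℤ × List ℕ)) :
    (collect E).val (wordVal f) = wordsVal f E := by
  induction E with
  | nil => rfl
  | cons p E ih =>
    rw [collect, List.foldr_cons, ← collect, hf.val_addCanonical, ih, add_comm]
    simp [wordsVal]

lemma val_addPit (c : ℤ) (w : List ℕ) (t : CoeffTree) :
    (addPit c w t).val (wordVal (altTensor 8 4)) =
      t.val (wordVal (altTensor 8 4)) + c • wordVal (altPit 8 4) w := by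
  simp only [addPit, pitTerms, List.foldr, isSkew_altTensor.val_addCanonical, applySign_smul,
    cond_true, cond_false]
  by_cases h : w.length = 8
  · simp only [wordVal_permuteRows _ h]
    rw [wordVal, if_pos h, altPit_eq]
    simp only [smul_sub, smul_neg]
    abel
  · have h' (i j k l : ℕ) : wordVal (altTensor 8 4) (permuteRows i j k l w) = 0 := by
      rw [wordVal, permuteRows, List.length_map, if_neg h]
    simp only [h', neg_zero, smul_zero, add_zero]
    rw [wordVal, if_neg h, smul_zero, add_zero]

lemma val_addTree (t t' : CoeffTree) :
    (addTree t t').val (wordVal (altTensor 8 4)) =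
      t'.val (wordVal (altTensor 8 4)) + t.val (wordVal (altPit 8 4)) := by
  induction t generalizing t' with
  | leaf => simp [addTree, CoeffTree.val]
  | node l c w r hl hr =>
    rcases c with (- | n) | n
    · rw [addTree, hl, hr, CoeffTree.val, Int.ofNat_eq_natCast, Nat.cast_zero, zero_smul]
      abel
    all_goals
      rw [addTree, hl, val_addPit, hr, CoeffTree.val]
      · abel
      · rintro ⟨⟩

lemma wordsVal_eq_zero {E : List (ℤ × List ℕ)} (h : checkWords E = true) :
    wordsVal (altPit 8 4) E = 0 := by
  have h' := val_addTree (collect E) .leaf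
  rw [isSkew_altPit.val_collect, CoeffTree.val_eq_zero _ h, CoeffTree.val, zero_add] at h'
  exact h'.symm

lemma wordsVal_scaleWords {M : Type*} [AddCommGroup M] (f : VF K4 → VF K4 → VF K4 → VF K4 → M)
    (n : ℤ) (E : List (ℤ × List ℕ)) : wordsVal f (scaleWords n E) = n • wordsVal f E := by
  simp only [wordsVal, scaleWords, List.map_map, List.smul_sum, Function.comp_def, mul_smul]

lemma IsSkew.wordsVal_tripleWords {M : Type*} [AddCommGroup M]
    {f : VF K4 → VF K4 → VF K4 → VF K4 → M} (hf : IsSkew f) {A B C X : List (ℤ × List ℕ)}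
    (hA : LengthEight A) (hB : LengthEight B) (hC : LengthEight C) (hX : LengthEight X) :
    wordsVal f (tripleWords A B C X) =
      f (combVal A) (combVal C) (combVal combZ) (combVal combZ)
        - f (combVal A) (combVal X) (combVal B) (combVal combZ)
        + f (combVal A) (combVal X) (combVal X) (combVal B) := by
  have hZ : LengthEight combZ := by simp [LengthEight, combZ]
  rw [tripleWords, wordsVal_append, wordsVal_append, wordsVal_scaleWords,
    hf.wordsVal_spliceCombs hA hC hZ hZ, hf.wordsVal_spliceCombs hA hX hB hZ,
    hf.wordsVal_spliceCombs hA hX hX hB, neg_smul, one_smul]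
  abel

/-- The part of the identity without the terms containing `[1 - z]`. -/
lemma altPit_combVal :
    altPit 8 4 (combVal combA₁) (combVal combC₁) (combVal combZ) (combVal combZ)
        - altPit 8 4 (combVal combA₁) (combVal combX₁) (combVal combB₁) (combVal combZ)
        + altPit 8 4 (combVal combA₁) (combVal combX₁) (combVal combX₁) (combVal combB₁)
        + (2 : ℤ) • (altPit 8 4 (combVal combA₂) (combVal combC₂) (combVal combZ) (combVal combZ)
        - altPit 8 4 (combVal combA₂) (combVal combX₂) (combVal combB₂) (combVal combZ)
        + altPit 8 4 (combVal combA₂) (combVal combX₂) (combVal combX₂) (combVal combB₂)) =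
      (56 : ℤ) • altPit 8 4 (combVal [(1, [1, 1, 1, 1, 0, 0, 0, 0])])
        (combVal [(1, [0, 1, 1, 1, 1, 0, 0, 0])]) (combVal [(1, [0, 0, 1, 1, 1, 1, 0, 0])])
        (combVal [(1, [0, 0, 0, 1, 1, 1, 1, 0])]) := by
  have h := wordsVal_eq_zero checkWords_allWords
  rw [allWords, wordsVal_append, wordsVal_append, wordsVal_scaleWords, wordsVal_scaleWords,
    isSkew_altPit.wordsVal_tripleWords, isSkew_altPit.wordsVal_tripleWords,
    isSkew_altPit.wordsVal_spliceCombs, neg_smul, ← add_assoc, ← sub_eq_add_neg,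
    sub_eq_zero] at h
  · exact h
  all_goals simp [LengthEight, combA₁, combB₁, combC₁, combX₁, combA₂, combB₂, combC₂, combX₂]

end Soundness

section Values

variable {N m : ℕ}

/-- The rational function `x` is regular at the point `pt`, with value `r`. -/
def HasVal (pt : Fin N × Fin m → ℚ) (x : FF N m) (r : ℚ) : Prop :=
  ∃ p q : Pol N m, MvPolynomial.eval pt q ≠ 0 ∧
    x * algebraMap (Pol N m) (FF N m) q = algebraMap (Pol N m) (FF N m) p ∧
    r * MvPolynomial.eval pt q = MvPolynomial.eval pt p

variable {pt : Fin N × Fin m → ℚ} {x y : FF N m} {r s : ℚ}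

lemma HasVal.ne_zero (h : HasVal pt x r) (hr : r ≠ 0) : x ≠ 0 := by
  rintro rfl
  obtain ⟨p, q, hq, hx, hp⟩ := h
  rw [zero_mul] at hx
  rw [(IsFractionRing.injective (Pol N m) (FF N m)) (hx.symm.trans (map_zero _).symm),
    map_zero] at hp
  exact mul_ne_zero hr hq hp

lemma hasVal_gen (i : Fin N) (j : Fin m) : HasVal pt (gen N m i j) (pt (i, j)) :=
  ⟨MvPolynomial.X (i, j), 1, by simp, by simp [gen], by simp⟩

lemma HasVal.add (hx : HasVal pt x r) (hy : HasVal pt y s) : HasVal pt (x + y) (r + s) := by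
  obtain ⟨p, q, hq, hx, hp⟩ := hx
  obtain ⟨p', q', hq', hy, hp'⟩ := hy
  refine ⟨p * q' + p' * q, q * q', ?_, ?_, ?_⟩
  · rw [map_mul]
    exact mul_ne_zero hq hq'
  · simp only [map_add, map_mul, ← hx, ← hy]
    ring
  · simp only [map_add, map_mul, ← hp, ← hp']
    ring

lemma HasVal.mul (hx : HasVal pt x r) (hy : HasVal pt y s) : HasVal pt (x * y) (r * s) := by
  obtain ⟨p, q, hq, hx, hp⟩ := hx
  obtain ⟨p', q', hq', hy, hp'⟩ := hy
  refine ⟨p * p', q * q', ?_, ?_, ?_⟩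
  · rw [map_mul]
    exact mul_ne_zero hq hq'
  · simp only [map_mul, ← hx, ← hy]
    ring
  · simp only [map_mul, ← hp, ← hp']
    ring

lemma HasVal.neg (hx : HasVal pt x r) : HasVal pt (-x) (-r) := by
  obtain ⟨p, q, hq, hx, hp⟩ := hx
  refine ⟨-p, q, hq, ?_, ?_⟩
  · rw [map_neg, ← hx, neg_mul]
  · rw [map_neg, ← hp, neg_mul]

lemma HasVal.sub (hx : HasVal pt x r) (hy : HasVal pt y s) : HasVal pt (x - y) (r - s) := by
  rw [sub_eq_add_neg, sub_eq_add_neg]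
  exact hx.add hy.neg

lemma HasVal.inv (hx : HasVal pt x r) (hr : r ≠ 0) : HasVal pt x⁻¹ r⁻¹ := by
  have hx0 := hx.ne_zero hr
  obtain ⟨p, q, hq, hx, hp⟩ := hx
  refine ⟨q, p, hp ▸ mul_ne_zero hr hq, ?_, ?_⟩
  · rw [← hx, inv_mul_cancel_left₀ hx0]
  · rw [← hp, inv_mul_cancel_left₀ hr]

lemma HasVal.div (hx : HasVal pt x r) (hy : HasVal pt y s) (hs : s ≠ 0) :
    HasVal pt (x / y) (r / s) := by
  rw [div_eq_mul_inv, div_eq_mul_inv]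
  exact hx.mul (hy.inv hs)

/-- Brackets of points on the moment curve. -/
lemma hasVal_brk (t : Fin N → ℚ) (a b c d : Fin N) :
    HasVal (fun p : Fin N × Fin 4 => t p.1 ^ (p.2 : ℕ)) (brk a b c d)
      ((t b - t a) * (t c - t a) * (t d - t a) * (t c - t b) * (t d - t b) * (t d - t c)) := by
  have h (i : Fin N) (j : Fin 4) :=
    hasVal_gen (pt := fun p : Fin N × Fin 4 => t p.1 ^ (p.2 : ℕ)) i j
  have h2 (i j : Fin N) (k l : Fin 4) := ((h i k).mul (h j l)).sub ((h i l).mul (h j k))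
  rw [brk_eq]
  convert ((((((h2 a b 0 1).mul (h2 c d 2 3)).sub ((h2 a b 0 2).mul (h2 c d 1 3))).add
    ((h2 a b 0 3).mul (h2 c d 1 2))).add ((h2 a b 1 2).mul (h2 c d 0 3))).sub
    ((h2 a b 1 3).mul (h2 c d 0 2))).add ((h2 a b 2 3).mul (h2 c d 0 1)) using 1
  simp only [Fin.val_zero, Fin.val_one, Fin.val_two, show ((3 : Fin 4) : ℕ) = 3 from rfl]
  ring

end Values

section Reduction

variable {N m : ℕ}

lemma altPit_zsmul_one (n : ℤ) (a b c d : VF (FF N m)) :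
    altPit N m (n • a) b c d = n • altPit N m a b c d :=
  map_zsmul (AddMonoidHom.mk' (fun x => altPit N m x b c d) fun x y => altPit_add_one x y b c d) n a

lemma altPit_sub_one (a a' b c d : VF (FF N m)) :
    altPit N m (a - a') b c d = altPit N m a b c d - altPit N m a' b c d :=
  map_sub (AddMonoidHom.mk' (fun x => altPit N m x b c d) fun x y => altPit_add_one x y b c d) a a'

lemma altPit_sub_two (a b b' c d : VF (FF N m)) :
    altPit N m a (b - b') c d = altPit N m a b c d - altPit N m a b' c d :=
  map_sub (AddMonoidHom.mk' (fun x => altPit N m a x c d) fun x y => altPit_add_two a x y c d) b b'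

lemma altPit_neg_two (a b c d : VF (FF N m)) :
    altPit N m a (-b) c d = -altPit N m a b c d :=
  map_neg (AddMonoidHom.mk' (fun x => altPit N m a x c d) fun x y => altPit_add_two a x y c d) b

lemma altPit_neg_three (a b c d : VF (FF N m)) :
    altPit N m a b (-c) d = -altPit N m a b c d :=
  map_neg (AddMonoidHom.mk' (fun x => altPit N m a b x d) fun x y => altPit_add_three a b x y d) c

/-- The terms of `S I_{3,1}(x, y)` without the factor `[x - y]`, in terms of `A = [(1 - x)/x]`,
`B = [(1 - y)/y]`, `X = [x]` and `Z = [y/x]`. -/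
noncomputable def triple (A B X Z : VF (FF N m)) : TP (FF N m) 4 :=
  altPit N m A (B + Z) Z Z - altPit N m A X B Z + altPit N m A X X B

lemma altL_Pit_SI31 {x y z : FF N m} (hx : x ≠ 0) (hx1 : x ≠ 1) (hy1 : y ≠ 1) (hz : z ≠ 0)
    (hz1 : z ≠ 1) (h : y = x * z) :
    altL N m 4 (Pit 4 (SI31 x y)) =
      triple (cls (1 - x) - cls x) (cls (1 - y) - cls y) (cls x) (cls z)
        + altPit N m ((cls (1 - y) - cls y) - (cls (1 - x) - cls x)) (cls (1 - z)) (cls z)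
          (cls z) := by
  have hy : y ≠ 0 := h ▸ mul_ne_zero hx hz
  have hxy : x ≠ y := fun h' => hz1 (mul_left_cancel₀ hx (by rw [← h, ← h', mul_one]))
  have h1 : cls (x - y) - cls x = cls (1 - z) := by
    rw [h, show x - x * z = x * (1 - z) by ring, cls_mul hx (sub_ne_zero.2 hz1.symm),
      add_sub_cancel_left]
  have h2 : cls y - cls x = cls z := by
    rw [h, cls_mul hx hz, add_sub_cancel_left]
  have h3 : cls (1 - y) - cls (x - y) = (cls (1 - y) - cls y + cls z) - cls (1 - z) := by
    rw [← h1, ← h2]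
    abel
  rw [SI31_eq hx hy hx1 hy1 hxy, h1, h2, h3]
  generalize cls (1 - x) - cls x = A, cls (1 - y) - cls y = B
  simp only [map_add]
  rw [← altPit, ← altPit, ← altPit, ← altPit, altPit_sub_two, altPit_sub_one _ _ (cls (1 - z)),
    altPit_neg_two, altPit_neg_two,
    altPit_neg_three, triple]
  abel

lemma altL_Pit_SLi4 {z : FF N m} (hz : z ≠ 0) (hz1 : z ≠ 1) :
    altL N m 4 (Pit 4 (SLi4 z)) = -altPit N m (cls (1 - z)) (cls z) (cls z) (cls z) := by
  rw [SLi4_eq hz hz1, map_neg, map_neg, altPit]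

lemma altPit_swap (a b : VF (FF N m)) :
    altPit N m b a b b = (-3 : ℤ) • altPit N m a b b b := by
  simp only [altPit_eq]
  abel

lemma altPit_of_symm (σ : Equiv.Perm (Fin N)) (hσ : Equiv.Perm.sign σ = 1) {q R Z : VF (FF N m)}
    (hq : vmap (permAut N m σ) q = q) (hZ : vmap (permAut N m σ) Z = Z)
    (hR : R + vmap (permAut N m σ) R = (-4 : ℤ) • Z) :
    altPit N m R q Z Z = (6 : ℤ) • altPit N m q Z Z Z := by
  have h := altPit_vmap σ R q Z Z
  rw [hq, hZ, hσ, Units.val_one, one_smul] at h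
  have h2 := altPit_add_one R (vmap (permAut N m σ) R) q Z Z
  rw [h, hR, altPit_zsmul_one, altPit_swap, smul_smul] at h2
  have h3 : (2 : ℚ) • altPit N m R q Z Z = (2 : ℚ) • (6 : ℤ) • altPit N m q Z Z Z := by
    rw [two_smul ℚ, ← h2, two_smul ℚ, ← add_smul]
    norm_num
  exact smul_right_injective _ (two_ne_zero (α := ℚ)) h3

end Reduction

section FourPoints

variable {N m : ℕ} {a b c d : FF N m}

/-- The skew-symmetrization of the right-hand side, for four functions whose inverses are permuted
by an even involution. -/
lemma Alt_Pit_eq (ha : a ≠ 0) (hb : b ≠ 0) (hc : c ≠ 0) (hd : d ≠ 0) (hab : a - b ≠ 0)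
    (hac : a - c ≠ 0) (had : a - d ≠ 0) (hbc : b - c ≠ 0) (hbd : b - d ≠ 0) (hcd : c - d ≠ 0)
    (hz : a * (c - b) - (a - b) * (c - d) ≠ 0)
    (σ : Equiv.Perm (Fin N)) (hσ : Equiv.Perm.sign σ = 1) (hσa : permAut N m σ a = d⁻¹)
    (hσb : permAut N m σ b = c⁻¹) (hσc : permAut N m σ c = b⁻¹) (hσd : permAut N m σ d = a⁻¹)
    {Z : VF (FF N m)} (hZ : cls a + cls (b - c) - cls (a - b) - cls (c - d) = Z) :
    Alt (Pit 4 (SI31 ((a - b) * (c - d) / ((c - b) * (a - d))) (a / (a - d))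
        + (2 : ℚ) • SI31 ((a - b) / a) ((c - b) / (c - d))
        + (6 : ℚ) • SLi4 (a * (c - b) / ((a - b) * (c - d))))) =
      triple (cls (a - c) + cls (b - d) - cls (a - b) - cls (c - d)) (cls d - cls a)
        (cls (a - b) + cls (c - d) - cls (b - c) - cls (a - d)) Z
      + (2 : ℤ) • triple (cls b - cls (a - b)) (cls (b - d) - cls (b - c)) (cls (a - b) - cls a)
        Z := by
  have hcb : c - b ≠ 0 := by rwa [← neg_sub, neg_ne_zero]
  have hz0 : a * (c - b) / ((a - b) * (c - d)) ≠ 0 :=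
    div_ne_zero (mul_ne_zero ha hcb) (mul_ne_zero hab hcd)
  have hz1 : a * (c - b) / ((a - b) * (c - d)) ≠ 1 := fun h =>
    hz (by rw [(div_eq_one_iff_eq (mul_ne_zero hab hcd)).1 h, sub_self])
  have hZ' : cls (a * (c - b) / ((a - b) * (c - d))) = Z := by
    rw [cls_div (mul_ne_zero ha hcb) (mul_ne_zero hab hcd), cls_mul ha hcb, cls_mul hab hcd,
      cls_sub_comm c b, ← hZ]
    abel
  have hx₁ : (1 : FF N m) - (a - b) * (c - d) / ((c - b) * (a - d)) =
      -((a - c) * (b - d) / ((c - b) * (a - d))) := by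
    field_simp
    ring
  have hy₁ : 1 - a / (a - d) = -(d / (a - d)) := by
    field_simp
    ring
  have hx₂ : 1 - (a - b) / a = b / a := by
    field_simp
    ring
  have hy₂ : 1 - (c - b) / (c - d) = (b - d) / (c - d) := by
    field_simp
    ring
  have ne_one {x u : FF N m} (h : 1 - x = u) (hu : u ≠ 0) : x ≠ 1 := by
    rintro rfl
    exact hu (by rw [← h, sub_self])
  have h1 := altL_Pit_SI31 (x := (a - b) * (c - d) / ((c - b) * (a - d))) (y := a / (a - d))
    (z := a * (c - b) / ((a - b) * (c - d)))
    (div_ne_zero (mul_ne_zero hab hcd) (mul_ne_zero hcb had))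
    (ne_one hx₁ (neg_ne_zero.2 (div_ne_zero (mul_ne_zero hac hbd) (mul_ne_zero hcb had))))
    (ne_one hy₁ (neg_ne_zero.2 (div_ne_zero hd had))) hz0 hz1 (by field_simp)
  have h2 := altL_Pit_SI31 (x := (a - b) / a) (y := (c - b) / (c - d))
    (z := a * (c - b) / ((a - b) * (c - d)))
    (div_ne_zero hab ha) (ne_one hx₂ (div_ne_zero hb ha)) (ne_one hy₂ (div_ne_zero hbd hcd))
    hz0 hz1 (by field_simp)
  rw [hx₁, hy₁, cls_neg, cls_neg, hZ', cls_div (mul_ne_zero hac hbd) (mul_ne_zero hcb had),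
    cls_div (mul_ne_zero hab hcd) (mul_ne_zero hcb had), cls_mul hac hbd, cls_mul hcb had,
    cls_mul hab hcd, cls_div hd had, cls_div ha had, cls_sub_comm c b,
    show cls (a - c) + cls (b - d) - (cls (b - c) + cls (a - d))
      - (cls (a - b) + cls (c - d) - (cls (b - c) + cls (a - d)))
      = cls (a - c) + cls (b - d) - cls (a - b) - cls (c - d) by abel, ← sub_sub,
    sub_sub_sub_cancel_right] at h1
  rw [hx₂, hy₂, hZ', cls_div hb ha, cls_div hab ha, cls_div hbd hcd, cls_div hcb hcd,
    cls_sub_comm c b, sub_sub_sub_cancel_right, sub_sub_sub_cancel_right] at h2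
  have h3 := altL_Pit_SLi4 hz0 hz1
  rw [hZ'] at h3
  have hvmap {x y x' y' : FF N m} (hx : x' ≠ 0) (hy : y' ≠ 0) (hxσ : permAut N m σ x = y'⁻¹)
      (hyσ : permAut N m σ y = x'⁻¹) (hxy : x' - y' ≠ 0) :
      vmap (permAut N m σ) (cls (x - y)) = cls (x' - y') - cls x' - cls y' := by
    rw [vmap_cls, map_sub, hxσ, hyσ, show y'⁻¹ - x'⁻¹ = (x' - y') / (x' * y') by field_simp,
      cls_div hxy (mul_ne_zero hx hy), cls_mul hx hy, sub_add_eq_sub_sub]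
  have hva : vmap (permAut N m σ) (cls a) = -cls d := by rw [vmap_cls, hσa, cls_inv hd]
  have hvb : vmap (permAut N m σ) (cls b) = -cls c := by rw [vmap_cls, hσb, cls_inv hc]
  have hvd : vmap (permAut N m σ) (cls d) = -cls a := by rw [vmap_cls, hσd, cls_inv ha]
  have hvab := hvmap hc hd hσa hσb hcd
  have hvac := hvmap hb hd hσa hσc hbd
  have hvbc := hvmap hb hc hσb hσc hbc
  have hvbd := hvmap ha hc hσb hσd hac
  have hvcd := hvmap ha hb hσc hσd hab
  have hσz : permAut N m σ (a * (c - b) / ((a - b) * (c - d))) =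
      a * (c - b) / ((a - b) * (c - d)) := by
    rw [map_div₀, map_mul, map_mul, map_sub, map_sub, map_sub, hσa, hσb, hσc, hσd,
      show b⁻¹ - c⁻¹ = (c - b) / (b * c) by field_simp,
      show d⁻¹ - c⁻¹ = (c - d) / (c * d) by field_simp,
      show b⁻¹ - a⁻¹ = (a - b) / (a * b) by field_simp]
    field_simp
  have h4 := altPit_of_symm σ hσ (q := cls (1 - a * (c - b) / ((a - b) * (c - d)))) (Z := Z)
    (R := (cls d - cls a - (cls (a - c) + cls (b - d) - cls (a - b) - cls (c - d)))
      + (2 : ℤ) • ((cls (b - d) - cls (b - c)) - (cls b - cls (a - b))))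
    (by rw [vmap_cls, map_sub, map_one, hσz]) (by rw [← hZ', vmap_cls, hσz])
    (by
      rw [← hZ]
      simp only [map_add, map_sub, map_zsmul, hva, hvb, hvd, hvab, hvac, hvbc, hvbd, hvcd]
      abel)
  rw [altPit_add_one, altPit_zsmul_one] at h4
  rw [← altL_apply]
  simp only [map_add, map_smul, h1, h2, h3]
  rw [show (2 : ℚ) = ((2 : ℤ) : ℚ) by norm_num, show (6 : ℚ) = ((6 : ℤ) : ℚ) by norm_num,
    Int.cast_smul_eq_zsmul, Int.cast_smul_eq_zsmul, smul_neg, ← h4, smul_add]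
  abel

end FourPoints

section Configuration

/-- The class of the letter with the colours given by a list. -/
noncomputable abbrev listLetter (l : List ℕ) : VF K4 := letter fun k => l.getD k 0 % 8

lemma listLetter_eq (t : Fin 3) {l : List ℕ} {p q : Fin 8 → Fin 8} (hpq : ∀ k, q (p k) = k)
    (h : ∀ k, l.getD (p k) 0 % 8 = letterColor t k) : listLetter l = cls (letterElt t p) :=
  letter_of_injective t (Function.LeftInverse.injective hpq) h

lemma combVal_nil : combVal [] = 0 := rfl

lemma combVal_cons (c : ℤ) (l : List ℕ) (V : List (ℤ × List ℕ)) :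
    combVal ((c, l) :: V) = c • listLetter l + combVal V := by
  rw [combVal, List.map_cons, List.sum_cons]
  rfl

lemma listLetter_1237 : listLetter [1, 1, 1, 0, 0, 0, 1, 0] = cls (brk (0 : Fin 8) 1 2 6) :=
  listLetter_eq 0 (p := ![0, 1, 2, 6, 3, 4, 5, 7]) (q := ![0, 1, 2, 4, 5, 6, 3, 7])
    (by intro k; fin_cases k <;> rfl) (by intro k; fin_cases k <;> rfl)

lemma listLetter_1238 : listLetter [1, 1, 1, 0, 0, 0, 0, 1] = cls (brk (0 : Fin 8) 1 2 7) :=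
  listLetter_eq 0 (p := ![0, 1, 2, 7, 3, 4, 5, 6]) (q := ![0, 1, 2, 4, 5, 6, 7, 3])
    (by intro k; fin_cases k <;> rfl) (by intro k; fin_cases k <;> rfl)

lemma listLetter_2347 : listLetter [0, 1, 1, 1, 0, 0, 1, 0] = cls (brk (1 : Fin 8) 2 3 6) :=
  listLetter_eq 0 (p := ![1, 2, 3, 6, 0, 4, 5, 7]) (q := ![4, 0, 1, 2, 5, 6, 3, 7])
    (by intro k; fin_cases k <;> rfl) (by intro k; fin_cases k <;> rfl)

lemma listLetter_2348 : listLetter [0, 1, 1, 1, 0, 0, 0, 1] = cls (brk (1 : Fin 8) 2 3 7) :=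
  listLetter_eq 0 (p := ![1, 2, 3, 7, 0, 4, 5, 6]) (q := ![4, 0, 1, 2, 5, 6, 7, 3])
    (by intro k; fin_cases k <;> rfl) (by intro k; fin_cases k <;> rfl)

lemma listLetter_3458 : listLetter [0, 0, 1, 1, 1, 0, 0, 1] = cls (brk (2 : Fin 8) 3 4 7) :=
  listLetter_eq 0 (p := ![2, 3, 4, 7, 0, 1, 5, 6]) (q := ![4, 5, 0, 1, 2, 6, 7, 3])
    (by intro k; fin_cases k <;> rfl) (by intro k; fin_cases k <;> rfl)

lemma listLetter_4567 : listLetter [0, 0, 0, 1, 1, 1, 1, 0] = cls (brk (3 : Fin 8) 4 5 6) :=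
  listLetter_eq 0 (p := ![3, 4, 5, 6, 0, 1, 2, 7]) (q := ![4, 5, 6, 0, 1, 2, 3, 7])
    (by intro k; fin_cases k <;> rfl) (by intro k; fin_cases k <;> rfl)

lemma listLetter_4568 : listLetter [0, 0, 0, 1, 1, 1, 0, 1] = cls (brk (3 : Fin 8) 4 5 7) :=
  listLetter_eq 0 (p := ![3, 4, 5, 7, 0, 1, 2, 6]) (q := ![4, 5, 6, 0, 1, 2, 7, 3])
    (by intro k; fin_cases k <;> rfl) (by intro k; fin_cases k <;> rfl)

lemma listLetter_1234 : listLetter [1, 1, 1, 1, 0, 0, 0, 0] = cls (brk (0 : Fin 8) 1 2 3) :=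
  listLetter_eq 0 (p := ![0, 1, 2, 3, 4, 5, 6, 7]) (q := ![0, 1, 2, 3, 4, 5, 6, 7])
    (by intro k; fin_cases k <;> rfl) (by intro k; fin_cases k <;> rfl)

lemma listLetter_2345 : listLetter [0, 1, 1, 1, 1, 0, 0, 0] = cls (brk (1 : Fin 8) 2 3 4) :=
  listLetter_eq 0 (p := ![1, 2, 3, 4, 0, 5, 6, 7]) (q := ![4, 0, 1, 2, 3, 5, 6, 7])
    (by intro k; fin_cases k <;> rfl) (by intro k; fin_cases k <;> rfl)

lemma listLetter_3456 : listLetter [0, 0, 1, 1, 1, 1, 0, 0] = cls (brk (2 : Fin 8) 3 4 5) :=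
  listLetter_eq 0 (p := ![2, 3, 4, 5, 0, 1, 6, 7]) (q := ![4, 5, 0, 1, 2, 3, 6, 7])
    (by intro k; fin_cases k <;> rfl) (by intro k; fin_cases k <;> rfl)

lemma listLetter_2378 : listLetter [0, 1, 1, 0, 0, 0, 1, 1] = cls (brk (1 : Fin 8) 2 6 7) :=
  listLetter_eq 0 (p := ![1, 2, 6, 7, 0, 3, 4, 5]) (q := ![4, 0, 1, 5, 6, 7, 2, 3])
    (by intro k; fin_cases k <;> rfl) (by intro k; fin_cases k <;> rfl)

lemma listLetter_3478 : listLetter [0, 0, 1, 1, 0, 0, 1, 1] = cls (brk (2 : Fin 8) 3 6 7) :=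
  listLetter_eq 0 (p := ![2, 3, 6, 7, 0, 1, 4, 5]) (q := ![4, 5, 0, 1, 6, 7, 2, 3])
    (by intro k; fin_cases k <;> rfl) (by intro k; fin_cases k <;> rfl)

lemma listLetter_4578 : listLetter [0, 0, 0, 1, 1, 0, 1, 1] = cls (brk (3 : Fin 8) 4 6 7) :=
  listLetter_eq 0 (p := ![3, 4, 6, 7, 0, 1, 2, 5]) (q := ![4, 5, 6, 0, 1, 7, 2, 3])
    (by intro k; fin_cases k <;> rfl) (by intro k; fin_cases k <;> rfl)

lemma listLetter_conc_two :
    listLetter [2, 2, 5, 3, 3, 6, 4, 4] = cls (conc (2 : Fin 8) 0 1 3 4 6 7) :=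
  listLetter_eq 1 (p := ![0, 1, 2, 3, 4, 5, 6, 7]) (q := ![0, 1, 2, 3, 4, 5, 6, 7])
    (by intro k; fin_cases k <;> rfl) (by intro k; fin_cases k <;> rfl)

lemma listLetter_conc_three :
    listLetter [6, 2, 2, 5, 3, 3, 4, 4] = cls (conc (3 : Fin 8) 1 2 4 5 6 7) :=
  listLetter_eq 1 (p := ![1, 2, 3, 4, 5, 0, 6, 7]) (q := ![5, 0, 1, 2, 3, 4, 6, 7])
    (by intro k; fin_cases k <;> rfl) (by intro k; fin_cases k <;> rfl)

lemma listLetter_meet :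
    listLetter [5, 5, 5, 6, 6, 6, 7, 7] = cls (meet (0 : Fin 8) 1 2 3 4 5 6 7) :=
  listLetter_eq 2 (p := ![0, 1, 2, 3, 4, 5, 6, 7]) (q := ![0, 1, 2, 3, 4, 5, 6, 7])
    (by intro k; fin_cases k <;> rfl) (by intro k; fin_cases k <;> rfl)

lemma brk_ne_zero {N : ℕ} {a b c d : Fin N} (hab : a < b) (hbc : b < c) (hcd : c < d) :
    brk a b c d ≠ 0 := by
  refine (hasVal_brk (fun i => ((i : ℕ) : ℚ)) a b c d).ne_zero ?_
  have h {i j : Fin N} (hij : i < j) : ((j : ℕ) : ℚ) - ((i : ℕ) : ℚ) ≠ 0 :=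
    sub_ne_zero.2 (Nat.cast_injective.ne (Fin.val_injective.ne hij.ne'))
  exact mul_ne_zero (mul_ne_zero (mul_ne_zero (mul_ne_zero (mul_ne_zero (h hab)
    (h (hab.trans hbc))) (h (hab.trans (hbc.trans hcd)))) (h hbc)) (h (hbc.trans hcd))) (h hcd)

lemma brk_div_sub_brk_div {N : ℕ} {a x y b e f : Fin N} (h₁ : brk a x y f ≠ 0)
    (h₂ : brk x y b f ≠ 0) :
    brk a x y e / brk a x y f - brk x y b e / brk x y b f =
      brk a x y b * brk x y e f / (brk a x y f * brk x y b f) := by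
  rw [div_sub_div _ _ h₁ h₂, ← brk_plucker x y a b e f, mul_comm (brk a x y f) (brk x y b e)]

lemma rho_one : rho 1 = brk (0 : Fin 8) 1 2 6 / brk (0 : Fin 8) 1 2 7 := rfl

lemma rho_two : rho 2 = brk (1 : Fin 8) 2 3 6 / brk (1 : Fin 8) 2 3 7 := rfl

lemma rho_three : rho 3 = brk (2 : Fin 8) 3 4 6 / brk (2 : Fin 8) 3 4 7 := rfl

lemma rho_four : rho 4 = brk (3 : Fin 8) 4 5 6 / brk (3 : Fin 8) 4 5 7 := rfl

/-- The matrix of coordinates of eight points on the moment curve. -/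
def momentCurve (p : Fin 8 × Fin 4) : ℚ := ((p.1 : ℕ) : ℚ) ^ (p.2 : ℕ)

lemma hasVal_brk_div_brk {a b c d e : Fin 8} (hab : a < b) (hbc : b < c) (hce : c < e) {r : ℚ}
    (h : (((d : ℕ) : ℚ) - (a : ℕ)) * (((d : ℕ) : ℚ) - (b : ℕ)) * (((d : ℕ) : ℚ) - (c : ℕ)) =
      r * ((((e : ℕ) : ℚ) - (a : ℕ)) * (((e : ℕ) : ℚ) - (b : ℕ)) * (((e : ℕ) : ℚ) - (c : ℕ)))) :
    HasVal momentCurve (brk a b c d / brk a b c e) r := by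
  have hlt {i j : Fin 8} (hij : i < j) : ((j : ℕ) : ℚ) - ((i : ℕ) : ℚ) ≠ 0 :=
    sub_ne_zero.2 (Nat.cast_injective.ne (Fin.val_injective.ne hij.ne'))
  have hne : (((b : ℕ) : ℚ) - (a : ℕ)) * (((c : ℕ) : ℚ) - (a : ℕ)) * (((e : ℕ) : ℚ) - (a : ℕ))
      * (((c : ℕ) : ℚ) - (b : ℕ)) * (((e : ℕ) : ℚ) - (b : ℕ)) * (((e : ℕ) : ℚ) - (c : ℕ)) ≠ 0 :=
    mul_ne_zero (mul_ne_zero (mul_ne_zero (mul_ne_zero (mul_ne_zero (hlt hab)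
      (hlt (hab.trans hbc))) (hlt (hab.trans (hbc.trans hce)))) (hlt hbc)) (hlt (hbc.trans hce)))
      (hlt hce)
  have hr : r = (((b : ℕ) : ℚ) - (a : ℕ)) * (((c : ℕ) : ℚ) - (a : ℕ)) * (((d : ℕ) : ℚ) - (a : ℕ))
      * (((c : ℕ) : ℚ) - (b : ℕ)) * (((d : ℕ) : ℚ) - (b : ℕ)) * (((d : ℕ) : ℚ) - (c : ℕ)) /
      ((((b : ℕ) : ℚ) - (a : ℕ)) * (((c : ℕ) : ℚ) - (a : ℕ)) * (((e : ℕ) : ℚ) - (a : ℕ))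
      * (((c : ℕ) : ℚ) - (b : ℕ)) * (((e : ℕ) : ℚ) - (b : ℕ)) * (((e : ℕ) : ℚ) - (c : ℕ))) := by
    rw [eq_div_iff hne]
    linear_combination -(((b : ℕ) : ℚ) - (a : ℕ)) * (((c : ℕ) : ℚ) - (a : ℕ))
      * (((c : ℕ) : ℚ) - (b : ℕ)) * h
  rw [hr]
  exact (hasVal_brk (fun i => ((i : ℕ) : ℚ)) a b c d).div
    (hasVal_brk (fun i => ((i : ℕ) : ℚ)) a b c e) hne

lemma hasVal_rho_one : HasVal momentCurve (rho 1) (4 / 7) := by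
  rw [rho_one]
  exact hasVal_brk_div_brk (by simp) (by simp) (by simp) (by norm_num)

lemma hasVal_rho_two : HasVal momentCurve (rho 2) (1 / 2) := by
  rw [rho_two]
  exact hasVal_brk_div_brk (by simp) (by simp) (by simp) (by norm_num)

lemma hasVal_rho_three : HasVal momentCurve (rho 3) (2 / 5) := by
  rw [rho_three]
  exact hasVal_brk_div_brk (by simp) (by simp) (by simp) (by norm_num)

lemma hasVal_rho_four : HasVal momentCurve (rho 4) (1 / 4) := by
  rw [rho_four]
  exact hasVal_brk_div_brk (by simp) (by simp) (by simp) (by norm_num)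

lemma cls_brk_div_brk {a b c d e : Fin 8} (hab : a < b) (hbc : b < c) (hcd : c < d) (hce : c < e) :
    cls (brk a b c d / brk a b c e) = cls (brk a b c d) - cls (brk a b c e) :=
  cls_div (brk_ne_zero hab hbc hcd) (brk_ne_zero hab hbc hce)

lemma cls_brk_div_sub {a x y b e f : Fin 8} (hax : a < x) (hxy : x < y) (hyb : y < b) (hbe : b < e)
    (hef : e < f) :
    cls (brk a x y e / brk a x y f - brk x y b e / brk x y b f) =
      cls (brk a x y b) + cls (brk x y e f) - cls (brk a x y f) - cls (brk x y b f) := by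
  have hye := hyb.trans hbe
  have h₁ := brk_ne_zero hax hxy (hye.trans hef)
  have h₂ := brk_ne_zero hxy hyb (hbe.trans hef)
  rw [brk_div_sub_brk_div h₁ h₂, cls_div (mul_ne_zero (brk_ne_zero hax hxy hyb)
    (brk_ne_zero hxy hye hef)) (mul_ne_zero h₁ h₂), cls_mul (brk_ne_zero hax hxy hyb)
    (brk_ne_zero hxy hye hef), cls_mul h₁ h₂, sub_add_eq_sub_sub]

/-- The class of a difference of two ratios. -/
lemma cls_div_sub_div {F : Type} [Field F] {a b c d : F} (hb : b ≠ 0) (hd : d ≠ 0)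
    (h : a / b - c / d ≠ 0) :
    cls (a / b - c / d) = cls (a * d - b * c) - cls b - cls d := by
  rw [div_sub_div _ _ hb hd] at h ⊢
  rw [cls_div (div_ne_zero_iff.1 h).1 (mul_ne_zero hb hd), cls_mul hb hd, sub_add_eq_sub_sub]

lemma rr_one_two_ne_zero : rr 1 2 ≠ 0 :=
  (hasVal_rho_one.sub hasVal_rho_two).ne_zero (by norm_num)

lemma rr_one_three_ne_zero : rr 1 3 ≠ 0 :=
  (hasVal_rho_one.sub hasVal_rho_three).ne_zero (by norm_num)

lemma rr_one_four_ne_zero : rr 1 4 ≠ 0 :=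
  (hasVal_rho_one.sub hasVal_rho_four).ne_zero (by norm_num)

lemma rr_two_three_ne_zero : rr 2 3 ≠ 0 :=
  (hasVal_rho_two.sub hasVal_rho_three).ne_zero (by norm_num)

lemma rr_two_four_ne_zero : rr 2 4 ≠ 0 :=
  (hasVal_rho_two.sub hasVal_rho_four).ne_zero (by norm_num)

lemma rr_three_four_ne_zero : rr 3 4 ≠ 0 :=
  (hasVal_rho_three.sub hasVal_rho_four).ne_zero (by norm_num)

lemma cls_rho_one : cls (rho 1) =
    listLetter [1, 1, 1, 0, 0, 0, 1, 0] - listLetter [1, 1, 1, 0, 0, 0, 0, 1] := by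
  rw [rho_one, listLetter_1237, listLetter_1238]
  exact cls_brk_div_brk (by simp) (by simp) (by simp) (by simp)

lemma cls_rho_two : cls (rho 2) =
    listLetter [0, 1, 1, 1, 0, 0, 1, 0] - listLetter [0, 1, 1, 1, 0, 0, 0, 1] := by
  rw [rho_two, listLetter_2347, listLetter_2348]
  exact cls_brk_div_brk (by simp) (by simp) (by simp) (by simp)

lemma cls_rho_four : cls (rho 4) =
    listLetter [0, 0, 0, 1, 1, 1, 1, 0] - listLetter [0, 0, 0, 1, 1, 1, 0, 1] := by
  rw [rho_four, listLetter_4567, listLetter_4568]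
  exact cls_brk_div_brk (by simp) (by simp) (by simp) (by simp)

lemma cls_rr_one_two : cls (rr 1 2) =
    listLetter [1, 1, 1, 1, 0, 0, 0, 0] + listLetter [0, 1, 1, 0, 0, 0, 1, 1]
      - listLetter [1, 1, 1, 0, 0, 0, 0, 1] - listLetter [0, 1, 1, 1, 0, 0, 0, 1] := by
  rw [rr, rho_one, rho_two, listLetter_1234, listLetter_2378, listLetter_1238, listLetter_2348]
  exact cls_brk_div_sub (by simp) (by simp) (by simp) (by simp) (by simp)

lemma cls_rr_two_three : cls (rr 2 3) =
    listLetter [0, 1, 1, 1, 1, 0, 0, 0] + listLetter [0, 0, 1, 1, 0, 0, 1, 1]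
      - listLetter [0, 1, 1, 1, 0, 0, 0, 1] - listLetter [0, 0, 1, 1, 1, 0, 0, 1] := by
  rw [rr, rho_two, rho_three, listLetter_2345, listLetter_3478, listLetter_2348, listLetter_3458]
  exact cls_brk_div_sub (by simp) (by simp) (by simp) (by simp) (by simp)

lemma cls_rr_three_four : cls (rr 3 4) =
    listLetter [0, 0, 1, 1, 1, 1, 0, 0] + listLetter [0, 0, 0, 1, 1, 0, 1, 1]
      - listLetter [0, 0, 1, 1, 1, 0, 0, 1] - listLetter [0, 0, 0, 1, 1, 1, 0, 1] := by
  rw [rr, rho_three, rho_four, listLetter_3456, listLetter_4578, listLetter_3458, listLetter_4568]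
  exact cls_brk_div_sub (by simp) (by simp) (by simp) (by simp) (by simp)

lemma cls_rr_one_three : cls (rr 1 3) = listLetter [2, 2, 5, 3, 3, 6, 4, 4]
    - listLetter [1, 1, 1, 0, 0, 0, 0, 1] - listLetter [0, 0, 1, 1, 1, 0, 0, 1] := by
  rw [rr, rho_one, rho_three, listLetter_conc_two, listLetter_1238, listLetter_3458]
  exact cls_div_sub_div (brk_ne_zero (by simp) (by simp) (by simp))
    (brk_ne_zero (by simp) (by simp) (by simp)) rr_one_three_ne_zero

lemma cls_rr_two_four : cls (rr 2 4) = listLetter [6, 2, 2, 5, 3, 3, 4, 4]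
    - listLetter [0, 1, 1, 1, 0, 0, 0, 1] - listLetter [0, 0, 0, 1, 1, 1, 0, 1] := by
  rw [rr, rho_two, rho_four, listLetter_conc_three, listLetter_2348, listLetter_4568]
  exact cls_div_sub_div (brk_ne_zero (by simp) (by simp) (by simp))
    (brk_ne_zero (by simp) (by simp) (by simp)) rr_two_four_ne_zero

lemma cls_rr_one_four : cls (rr 1 4) = listLetter [5, 5, 5, 6, 6, 6, 7, 7]
    - listLetter [1, 1, 1, 0, 0, 0, 0, 1] - listLetter [0, 0, 0, 1, 1, 1, 0, 1] := by
  rw [rr, rho_one, rho_four, listLetter_meet, listLetter_1238, listLetter_4568]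
  exact cls_div_sub_div (brk_ne_zero (by simp) (by simp) (by simp))
    (brk_ne_zero (by simp) (by simp) (by simp)) rr_one_four_ne_zero

end Configuration

section Conclusion

lemma smul_Pit_smul_Alt {N m : ℕ} (r s : ℚ) (a b c d : VF (FF N m)) :
    r • Pit 4 (s • Alt (tprod ℚ ![a, b, c, d])) = (r * s) • altPit N m a b c d := by
  rw [map_smul, smul_smul, ← altL_apply, Pit_four_altL, altPit]

lemma smul_Pit_SGr4 : ((7 : ℚ) / 144) • Pit 4 SGr4 =
    (56 : ℤ) • altPit 8 4 (listLetter [1, 1, 1, 1, 0, 0, 0, 0])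
      (listLetter [0, 1, 1, 1, 1, 0, 0, 0]) (listLetter [0, 0, 1, 1, 1, 1, 0, 0])
      (listLetter [0, 0, 0, 1, 1, 1, 1, 0]) := by
  rw [listLetter_1234, listLetter_2345, listLetter_3456, listLetter_4567,
    ← Int.cast_smul_eq_zsmul ℚ,
    show ((56 : ℤ) : ℚ) = 7 / 144 * (2 * (Nat.factorial 4 : ℚ) ^ 2) by norm_num [Nat.factorial]]
  exact smul_Pit_smul_Alt _ _ _ _ _ _

/-- The permutation `(16)(25)(34)(78)` of the eight vectors. -/
def flipPerm : Equiv.Perm (Fin 8) :=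
  Equiv.swap 0 5 * Equiv.swap 1 4 * Equiv.swap 2 3 * Equiv.swap 6 7

lemma sign_flipPerm : Equiv.Perm.sign flipPerm = 1 := by
  simp [flipPerm]

lemma flipPerm_apply (k : Fin 8) : flipPerm k = ![5, 4, 3, 2, 1, 0, 7, 6] k := by
  fin_cases k <;> rfl

lemma permAut_rho_one : permAut 8 4 flipPerm (rho 1) = (rho 4)⁻¹ := by
  rw [rho_one, rho_four, map_div₀, permAut_brk, permAut_brk, inv_div, ← neg_div_neg_eq]
  simp only [flipPerm_apply, Matrix.cons_val]
  rw [← brk_reverse, ← brk_reverse]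

lemma permAut_rho_two : permAut 8 4 flipPerm (rho 2) = (rho 3)⁻¹ := by
  rw [rho_two, rho_three, map_div₀, permAut_brk, permAut_brk, inv_div, ← neg_div_neg_eq]
  simp only [flipPerm_apply, Matrix.cons_val]
  rw [← brk_reverse, ← brk_reverse]

lemma permAut_rho_three : permAut 8 4 flipPerm (rho 3) = (rho 2)⁻¹ := by
  rw [rho_two, rho_three, map_div₀, permAut_brk, permAut_brk, inv_div, ← neg_div_neg_eq]
  simp only [flipPerm_apply, Matrix.cons_val]
  rw [← brk_reverse, ← brk_reverse]

lemma permAut_rho_four : permAut 8 4 flipPerm (rho 4) = (rho 1)⁻¹ := by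
  rw [rho_one, rho_four, map_div₀, permAut_brk, permAut_brk, inv_div, ← neg_div_neg_eq]
  simp only [flipPerm_apply, Matrix.cons_val]
  rw [← brk_reverse, ← brk_reverse]

lemma combVal_singleton (l : List ℕ) : combVal [(1, l)] = listLetter l := by
  rw [combVal_cons, one_smul, combVal_nil, add_zero]

/-- The integral combination of the values of a function described by a list. -/
def combEval {M : Type*} [AddCommGroup M] (g : List ℕ → M) (V : List (ℤ × List ℕ)) : M :=
  (V.map fun p => p.1 • g p.2).sum

section Combinations

variable {M : Type*} [AddCommGroup M] (g : List ℕ → M)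

lemma combEval_combZ :
     combEval g combZ = (g [1, 1, 1, 0, 0, 0, 1, 0] - g [1, 1, 1, 0, 0, 0, 0, 1])
      + (g [0, 1, 1, 1, 1, 0, 0, 0] + g [0, 0, 1, 1, 0, 0, 1, 1] - g [0, 1, 1, 1, 0, 0, 0, 1]
      - g [0, 0, 1, 1, 1, 0, 0, 1]) - (g [1, 1, 1, 1, 0, 0, 0, 0] + g [0, 1, 1, 0, 0, 0, 1, 1]
      - g [1, 1, 1, 0, 0, 0, 0, 1] - g [0, 1, 1, 1, 0, 0, 0, 1]) - (g [0, 0, 1, 1, 1, 1, 0, 0]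
      + g [0, 0, 0, 1, 1, 0, 1, 1] - g [0, 0, 1, 1, 1, 0, 0, 1] - g [0, 0, 0, 1, 1, 1, 0, 1]) := by
  simp [combEval, combZ]
  abel

lemma combEval_combX₁ :
     combEval g combX₁ = (g [1, 1, 1, 1, 0, 0, 0, 0] + g [0, 1, 1, 0, 0, 0, 1, 1]
      - g [1, 1, 1, 0, 0, 0, 0, 1] - g [0, 1, 1, 1, 0, 0, 0, 1]) + (g [0, 0, 1, 1, 1, 1, 0, 0]
      + g [0, 0, 0, 1, 1, 0, 1, 1] - g [0, 0, 1, 1, 1, 0, 0, 1] - g [0, 0, 0, 1, 1, 1, 0, 1])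
      - (g [0, 1, 1, 1, 1, 0, 0, 0] + g [0, 0, 1, 1, 0, 0, 1, 1] - g [0, 1, 1, 1, 0, 0, 0, 1]
      - g [0, 0, 1, 1, 1, 0, 0, 1]) - (g [5, 5, 5, 6, 6, 6, 7, 7] - g [1, 1, 1, 0, 0, 0, 0, 1]
      - g [0, 0, 0, 1, 1, 1, 0, 1]) := by
  simp [combEval, combX₁]
  abel

lemma combEval_combA₁ :
     combEval g combA₁ = (g [2, 2, 5, 3, 3, 6, 4, 4] - g [1, 1, 1, 0, 0, 0, 0, 1]
      - g [0, 0, 1, 1, 1, 0, 0, 1]) + (g [6, 2, 2, 5, 3, 3, 4, 4] - g [0, 1, 1, 1, 0, 0, 0, 1]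
      - g [0, 0, 0, 1, 1, 1, 0, 1]) - (g [1, 1, 1, 1, 0, 0, 0, 0] + g [0, 1, 1, 0, 0, 0, 1, 1]
      - g [1, 1, 1, 0, 0, 0, 0, 1] - g [0, 1, 1, 1, 0, 0, 0, 1]) - (g [0, 0, 1, 1, 1, 1, 0, 0]
      + g [0, 0, 0, 1, 1, 0, 1, 1] - g [0, 0, 1, 1, 1, 0, 0, 1] - g [0, 0, 0, 1, 1, 1, 0, 1]) := by
  simp [combEval, combA₁]
  abel

lemma combEval_combB₁ :
     combEval g combB₁ = (g [0, 0, 0, 1, 1, 1, 1, 0] - g [0, 0, 0, 1, 1, 1, 0, 1])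
      - (g [1, 1, 1, 0, 0, 0, 1, 0] - g [1, 1, 1, 0, 0, 0, 0, 1]) := by
  simp [combEval, combB₁]
  abel

lemma combEval_combC₁ :  combEval g combC₁ = combEval g combB₁ + combEval g combZ := by
  simp [combEval, combC₁, combB₁, combZ]
  abel

lemma combEval_combX₂ :
     combEval g combX₂ = (g [1, 1, 1, 1, 0, 0, 0, 0] + g [0, 1, 1, 0, 0, 0, 1, 1]
      - g [1, 1, 1, 0, 0, 0, 0, 1] - g [0, 1, 1, 1, 0, 0, 0, 1]) - (g [1, 1, 1, 0, 0, 0, 1, 0]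
      - g [1, 1, 1, 0, 0, 0, 0, 1]) := by
  simp [combEval, combX₂]
  abel

lemma combEval_combA₂ :
     combEval g combA₂ = (g [0, 1, 1, 1, 0, 0, 1, 0] - g [0, 1, 1, 1, 0, 0, 0, 1])
      - (g [1, 1, 1, 1, 0, 0, 0, 0] + g [0, 1, 1, 0, 0, 0, 1, 1] - g [1, 1, 1, 0, 0, 0, 0, 1]
      - g [0, 1, 1, 1, 0, 0, 0, 1]) := by
  simp [combEval, combA₂]
  abel

lemma combEval_combB₂ :
     combEval g combB₂ = (g [6, 2, 2, 5, 3, 3, 4, 4] - g [0, 1, 1, 1, 0, 0, 0, 1]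
      - g [0, 0, 0, 1, 1, 1, 0, 1]) - (g [0, 1, 1, 1, 1, 0, 0, 0] + g [0, 0, 1, 1, 0, 0, 1, 1]
      - g [0, 1, 1, 1, 0, 0, 0, 1] - g [0, 0, 1, 1, 1, 0, 0, 1]) := by
  simp [combEval, combB₂]
  abel

lemma combEval_combC₂ :  combEval g combC₂ = combEval g combB₂ + combEval g combZ := by
  simp [combEval, combC₂, combB₂, combZ]
  abel

end Combinations

lemma combVal_combZ :
    combVal combZ = cls (rho 1) + cls (rr 2 3) - cls (rr 1 2) - cls (rr 3 4) := by
  rw [cls_rho_one, cls_rr_two_three, cls_rr_one_two, cls_rr_three_four]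
  exact combEval_combZ listLetter

lemma combVal_combX₁ :
    combVal combX₁ = cls (rr 1 2) + cls (rr 3 4) - cls (rr 2 3) - cls (rr 1 4) := by
  rw [cls_rr_one_two, cls_rr_three_four, cls_rr_two_three, cls_rr_one_four]
  exact combEval_combX₁ listLetter

lemma combVal_combA₁ :
    combVal combA₁ = cls (rr 1 3) + cls (rr 2 4) - cls (rr 1 2) - cls (rr 3 4) := by
  rw [cls_rr_one_three, cls_rr_two_four, cls_rr_one_two, cls_rr_three_four]
  exact combEval_combA₁ listLetter

lemma combVal_combB₁ : combVal combB₁ = cls (rho 4) - cls (rho 1) := by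
  rw [cls_rho_four, cls_rho_one]
  exact combEval_combB₁ listLetter

lemma combVal_combC₁ : combVal combC₁ = combVal combB₁ + combVal combZ :=
  combEval_combC₁ listLetter

lemma combVal_combX₂ : combVal combX₂ = cls (rr 1 2) - cls (rho 1) := by
  rw [cls_rr_one_two, cls_rho_one]
  exact combEval_combX₂ listLetter

lemma combVal_combA₂ : combVal combA₂ = cls (rho 2) - cls (rr 1 2) := by
  rw [cls_rho_two, cls_rr_one_two]
  exact combEval_combA₂ listLetter

lemma combVal_combB₂ : combVal combB₂ = cls (rr 2 4) - cls (rr 2 3) := by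
  rw [cls_rr_two_four, cls_rr_two_three]
  exact combEval_combB₂ listLetter

lemma combVal_combC₂ : combVal combC₂ = combVal combB₂ + combVal combZ :=
  combEval_combC₂ listLetter

end Conclusion

end GrassPoly

open GrassPoly

/-- Theorem `gr4toi31_2`: the mod-products symbol identity
`(7/144)·S^⧢(Gr₄) = Alt₈ S^⧢[I_{3,1}(ρ₁₂ρ₃₄/(ρ₃₂ρ₁₄), ρ₁/ρ₁₄)
  + 2 I_{3,1}(ρ₁₂/ρ₁, ρ₃₂/ρ₃₄) + 6 Li₄(ρ₁ρ₃₂/(ρ₁₂ρ₃₄))]`. -/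
theorem gr4_to_i31 :
    ((7 : ℚ) / 144) • Pit 4 SGr4 =
      Alt (Pit 4 (SI31 (rr 1 2 * rr 3 4 / (rr 3 2 * rr 1 4)) (rho 1 / rr 1 4)
        + (2 : ℚ) • SI31 (rr 1 2 / rho 1) (rr 3 2 / rr 3 4)
        + (6 : ℚ) • SLi4 (rho 1 * rr 3 2 / (rr 1 2 * rr 3 4)))) := by
  have hz : rho 1 * (rho 3 - rho 2) - (rho 1 - rho 2) * (rho 3 - rho 4) ≠ 0 :=
    ((hasVal_rho_one.mul (hasVal_rho_three.sub hasVal_rho_two)).sub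
      ((hasVal_rho_one.sub hasVal_rho_two).mul
        (hasVal_rho_three.sub hasVal_rho_four))).ne_zero (by norm_num)
  have h := altPit_combVal
  rw [combVal_combC₁, combVal_combC₂, combVal_singleton, combVal_singleton, combVal_singleton,
    combVal_singleton, ← smul_Pit_SGr4, ← triple, ← triple, combVal_combA₁, combVal_combB₁,
    combVal_combX₁, combVal_combA₂, combVal_combB₂, combVal_combX₂] at h
  rw [← h]
  exact (Alt_Pit_eq (hasVal_rho_one.ne_zero (by norm_num)) (hasVal_rho_two.ne_zero (by norm_num))
    (hasVal_rho_three.ne_zero (by norm_num)) (hasVal_rho_four.ne_zero (by norm_num))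
    rr_one_two_ne_zero rr_one_three_ne_zero rr_one_four_ne_zero rr_two_three_ne_zero
    rr_two_four_ne_zero rr_three_four_ne_zero hz flipPerm sign_flipPerm permAut_rho_one
    permAut_rho_two permAut_rho_three permAut_rho_four combVal_combZ.symm).symm
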